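/- arXiv:1806.11024 — 6 statements merged into one kernel-verified Lean document; each statement's English description precedes it below -/
import Mathlib

section
/- Let φ = f_1 w_1 + f_2 w_2 + … + f_n w_n be a G-invariant element of k[V_m] ⊗ V_n (a covariant). Then f_i = Δ^{i−1}(f_1) for all i = 1,…,n, and Δ^n(f_1) = 0; in particular there exists f ∈ k[V_m] of weight at most n with f_i = Δ^{i−1}(f) for all i. -/
open MvPolynomial

/-- The algebra automorphism `σ` of `k[V_m] = k[x_1,…,x_m]` given by
`σ x_i = x_i + x_{i+1}` for `i < m` and `σ x_m = x_m` (0-indexed). -/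
noncomputable def sigmaHom (k : Type*) [CommRing k] (m : ℕ) :
    MvPolynomial (Fin m) k →ₐ[k] MvPolynomial (Fin m) k :=
  aeval (fun i : Fin m =>
    X i + if h : (i : ℕ) + 1 < m then X (⟨(i : ℕ) + 1, h⟩ : Fin m) else 0)

/-- The twisted derivation `Δ = σ - 1` as a `k`-linear endomorphism of `k[V_m]`. -/
noncomputable def delta (k : Type*) [CommRing k] (m : ℕ) :
    Module.End k (MvPolynomial (Fin m) k) :=
  (sigmaHom k m).toLinearMap - LinearMap.id

/-- Consecutive alternating tail sums of `a` add up to a single term of `a`. -/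
theorem alternating_tail_add_tail {R : Type*} [CommRing R] {n : ℕ} (a : Fin n → R) (i : Fin n) :
    (∑ j : Fin n, if (i : ℕ) ≤ (j : ℕ) then (-1 : R) ^ ((j : ℕ) - (i : ℕ)) * a j else 0) +
      (∑ j : Fin n, if (i : ℕ) + 1 ≤ (j : ℕ) then
        (-1 : R) ^ ((j : ℕ) - ((i : ℕ) + 1)) * a j else 0) = a i := by
  rw [← Finset.sum_add_distrib, Finset.sum_eq_single i]
  · simp
  · intro j _ hj
    have hne : (j : ℕ) ≠ i := fun h => hj (Fin.ext h)
    by_cases hij : (i : ℕ) ≤ j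
    · have hlt : (i : ℕ) + 1 ≤ j := by omega
      have hsub : (j : ℕ) - i = (j - (i + 1)) + 1 := by omega
      rw [if_pos hij, if_pos hlt, hsub]
      ring
    · rw [if_neg hij, if_neg (by omega), add_zero]
  · simp

/-- Identify `k[V_m] ⊗ V_n` with `Fin n → k[V_m]` via the basis `w_1, …, w_n`
(0-indexed).  Since `σ w_j = Σ_{i ≤ j} (-1)^{j-i} w_i`, the diagonal action of
`σ` sends `φ` to `fun i => Σ_{j ≥ i} (-1)^{j-i} σ(φ j)`.  If `φ` is a covariant,
i.e. `σ · φ = φ`, then `φ i = Δ^{i-1}(φ 1)` for all `i` and `Δ^n (φ 1) = 0`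
(so `φ 1` has weight at most `n`). -/
theorem statement2 (p : ℕ) (hp : p.Prime) (k : Type*) [Field k] [CharP k p]
    (m : ℕ) (hm : 1 ≤ m) (hmp : m ≤ p)
    (n : ℕ) (hn : 1 ≤ n) (hnp : n ≤ p)
    (φ : Fin n → MvPolynomial (Fin m) k)
    (hφ : ∀ i : Fin n,
      (∑ j : Fin n, if (i : ℕ) ≤ (j : ℕ) then
        (-1 : MvPolynomial (Fin m) k) ^ ((j : ℕ) - (i : ℕ)) * sigmaHom k m (φ j) else 0)
      = φ i) :
    (∀ i : Fin n, φ i = (delta k m ^ (i : ℕ)) (φ ⟨0, hn⟩)) ∧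
      (delta k m ^ n) (φ ⟨0, hn⟩) = 0 := by
  have delta_apply (f : MvPolynomial (Fin m) k) : delta k m f = sigmaHom k m f - f := by
    simp [delta]
  have hstep (i : ℕ) (hi : i + 1 < n) :
      φ ⟨i + 1, hi⟩ = delta k m (φ ⟨i, by omega⟩) := by
    have h := alternating_tail_add_tail (fun j => sigmaHom k m (φ j)) ⟨i, by omega⟩
    rw [hφ ⟨i, by omega⟩] at h
    have h' := hφ ⟨i + 1, hi⟩
    simp only at h h'
    rw [h'] at h
    rw [delta_apply, ← h]
    ring
  have hlast : delta k m (φ ⟨n - 1, by omega⟩) = 0 := by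
    have h := alternating_tail_add_tail (fun j => sigmaHom k m (φ j)) ⟨n - 1, by omega⟩
    rw [hφ ⟨n - 1, by omega⟩, Finset.sum_eq_zero, add_zero] at h
    · rw [delta_apply, ← h, sub_self]
    · intro j _
      exact if_neg (by have := j.isLt; simp only; omega)
  have hpow (i : ℕ) (hi : i < n) : φ ⟨i, hi⟩ = (delta k m ^ i) (φ ⟨0, hn⟩) := by
    induction i with
    | zero => simp
    | succ i ih => rw [hstep i hi, ih (by omega), pow_succ', Module.End.mul_apply]
  refine ⟨fun i => hpow i i.isLt, ?_⟩
  rw [hpow (n - 1) (by omega), ← Module.End.mul_apply, ← pow_succ', Nat.sub_add_cancel hn] at hlast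
  exact hlast
end

section
/- The map Θ : K_n → k[V_m]^G(V_n) defined by Θ(f) = Σ_{i=1}^{n} Δ^{i−1}(f) ⊗ w_i is a well-defined, degree-preserving bijection from K_n = ker(Δ^n) ⊆ k[V_m] onto the module of covariants k[V_m]^G(V_n). -/
open MvPolynomial

/-- `Θ(f) = Σ_{i=1}^{n} Δ^{i−1}(f) ⊗ w_i`, written in the coordinates of the
basis `w_1, …, w_n` of `V_n` (0-indexed). -/
noncomputable def theta (k : Type*) [CommRing k] (m n : ℕ)
    (f : MvPolynomial (Fin m) k) : Fin n → MvPolynomial (Fin m) k :=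
  fun i => (delta k m ^ (i : ℕ)) f

/-- The alternating tail sums `∑_{j ≥ i} (-1)^{j-i} a_j` coincide with a sequence `ψ` vanishing
at `n` if and only if `a_i = ψ_i + ψ_{i+1}` for all `i < n`. -/
theorem alternating_tail_sum_eq_iff {R : Type*} [CommRing R] {n : ℕ} (a : Fin n → R) (ψ : ℕ → R)
    (hψ : ψ n = 0) :
    (∀ i : Fin n, (∑ j : Fin n, if (i : ℕ) ≤ (j : ℕ) then
        (-1 : R) ^ ((j : ℕ) - (i : ℕ)) * a j else 0) = ψ i) ↔
      ∀ i : Fin n, a i = ψ i + ψ (i + 1) := by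
  set T : ℕ → R := fun i => ∑ j : Fin n, if i ≤ (j : ℕ) then
    (-1 : R) ^ ((j : ℕ) - i) * a j else 0 with hT
  have hn : T n = 0 := Finset.sum_eq_zero fun j _ => if_neg (by omega)
  have hrec (i : Fin n) : T i + T (i + 1) = a i := by
    rw [hT, ← Finset.sum_add_distrib, Finset.sum_eq_single i]
    · simp
    · intro j _ hj
      have hj' : (j : ℕ) ≠ i := fun h => hj (Fin.ext h)
      by_cases h : (i : ℕ) + 1 ≤ j
      · rw [if_pos h, if_pos (by omega),
          show (j : ℕ) - i = ((j : ℕ) - (i + 1)) + 1 by omega, pow_succ]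
        ring
      · rw [if_neg h, if_neg (by omega), add_zero]
    · simp
  change (∀ i : Fin n, T i = ψ i) ↔ _
  constructor
  · intro h i
    have hsucc : T (i + 1) = ψ (i + 1) := by
      rcases Nat.lt_or_ge ((i : ℕ) + 1) n with hi | hi
      · exact h ⟨i + 1, hi⟩
      · rw [show (i : ℕ) + 1 = n by omega, hn, hψ]
    rw [← hrec, h, hsucc]
  · intro h i
    refine Nat.decreasingInduction' (P := fun i => T i = ψ i) (m := i) (n := n)
      (fun l hl _ ih => ?_) i.isLt.le (hn.trans hψ.symm)
    have := (hrec ⟨l, hl⟩).trans (h ⟨l, hl⟩)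
    dsimp only at this ih
    rwa [ih, add_left_inj] at this

theorem sigmaHom_eq_add_delta {k : Type*} [CommRing k] {m : ℕ} (f : MvPolynomial (Fin m) k) :
    sigmaHom k m f = f + delta k m f := by
  simp [delta]

theorem sigmaHom_isHomogeneous {k : Type*} [CommRing k] {m d : ℕ} {f : MvPolynomial (Fin m) k}
    (hf : f.IsHomogeneous d) : (sigmaHom k m f).IsHomogeneous d := by
  rw [← one_mul d]
  refine hf.aeval _ fun i => (isHomogeneous_X k i).add ?_
  split_ifs
  · exact isHomogeneous_X k _
  · exact isHomogeneous_zero _ _ _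

theorem delta_isHomogeneous {k : Type*} [CommRing k] {m d : ℕ} {f : MvPolynomial (Fin m) k}
    (hf : f.IsHomogeneous d) : (delta k m f).IsHomogeneous d :=
  (sigmaHom_isHomogeneous hf).sub hf

theorem delta_pow_isHomogeneous {k : Type*} [CommRing k] {m d : ℕ} {f : MvPolynomial (Fin m) k}
    (hf : f.IsHomogeneous d) (i : ℕ) : ((delta k m ^ i) f).IsHomogeneous d := by
  induction i with
  | zero => simpa using hf
  | succ i ih =>
    rw [pow_succ', Module.End.mul_apply]
    exact delta_isHomogeneous ih

/-- In the coordinates of the basis `w_1, …, w_n`, the diagonal action of `σ`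
on `k[V_m] ⊗ V_n` sends `φ` to `fun i => Σ_{j ≥ i} (-1)^{j-i} σ(φ j)`; a
covariant is a fixed point of this action.  The map `Θ : K_n → k[V_m]^G(V_n)`,
`Θ(f) = Σ_i Δ^{i-1}(f) ⊗ w_i`, is a well-defined, degree-preserving bijection
from `K_n = ker(Δ^n)` onto the module of covariants. -/
theorem statement3 (p : ℕ) (hp : p.Prime) (k : Type*) [Field k] [CharP k p]
    (m : ℕ) (hm : 1 ≤ m) (hmp : m ≤ p)
    (n : ℕ) (hn : 1 ≤ n) (hnp : n ≤ p) :
    -- well-defined: `Θ(f)` is a covariant for every `f ∈ K_n`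
    (∀ f : MvPolynomial (Fin m) k, (delta k m ^ n) f = 0 →
      ∀ i : Fin n,
        (∑ j : Fin n, if (i : ℕ) ≤ (j : ℕ) then
          (-1 : MvPolynomial (Fin m) k) ^ ((j : ℕ) - (i : ℕ)) *
            sigmaHom k m (theta k m n f j) else 0)
        = theta k m n f i) ∧
    -- injective on `K_n`
    (∀ f g : MvPolynomial (Fin m) k, (delta k m ^ n) f = 0 → (delta k m ^ n) g = 0 →
      theta k m n f = theta k m n g → f = g) ∧
    -- surjective onto the covariants
    (∀ φ : Fin n → MvPolynomial (Fin m) k,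
      (∀ i : Fin n,
        (∑ j : Fin n, if (i : ℕ) ≤ (j : ℕ) then
          (-1 : MvPolynomial (Fin m) k) ^ ((j : ℕ) - (i : ℕ)) * sigmaHom k m (φ j) else 0)
        = φ i) →
      ∃ f : MvPolynomial (Fin m) k, (delta k m ^ n) f = 0 ∧ theta k m n f = φ) ∧
    -- degree-preserving
    (∀ (d : ℕ) (f : MvPolynomial (Fin m) k), (delta k m ^ n) f = 0 →
      f ∈ homogeneousSubmodule (Fin m) k d →
      ∀ i : Fin n, theta k m n f i ∈ homogeneousSubmodule (Fin m) k d) := by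
  refine ⟨fun f hf => ?_, fun f g _ _ h => ?_, fun φ hφ => ?_, fun d f _ hd i => ?_⟩
  · refine (alternating_tail_sum_eq_iff (fun j => sigmaHom k m (theta k m n f j))
      (fun i => (delta k m ^ i) f) hf).2 fun i => ?_
    simp only [theta, sigmaHom_eq_add_delta, pow_succ', Module.End.mul_apply]
  · simpa [theta] using congrFun h ⟨0, hn⟩
  · set ψ : ℕ → MvPolynomial (Fin m) k := fun i => if h : i < n then φ ⟨i, h⟩ else 0 with hψ
    have hψn : ψ n = 0 := dif_neg (lt_irrefl n)
    have hψφ (i : Fin n) : ψ i = φ i := dif_pos i.isLt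
    have hrec := (alternating_tail_sum_eq_iff (fun j => sigmaHom k m (φ j)) ψ hψn).1
      fun i => (hφ i).trans (hψφ i).symm
    have hpow (i : ℕ) (hi : i ≤ n) : (delta k m ^ i) (ψ 0) = ψ i := by
      induction i with
      | zero => simp
      | succ i ih =>
        rw [pow_succ', Module.End.mul_apply, ih (by omega)]
        have := hrec ⟨i, hi⟩
        rw [sigmaHom_eq_add_delta, ← hψφ] at this
        exact add_left_cancel this
    exact ⟨ψ 0, (hpow n le_rfl).trans hψn, funext fun i => (hpow i i.isLt.le).trans (hψφ i)⟩
  · exact delta_pow_isHomogeneous hd i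
end

section
/- For 1 ≤ k ≤ p−1, the multiplicity of the indecomposable module V_k in the degree-d homogeneous component k[V_2]_d equals 1 if d ≡ k−1 (mod p) and 0 otherwise; equivalently, the generating series H_k(k[V_2],t) = Σ_{d≥0} μ_k(k[V_2]_d) t^d equals t^{k−1}/(1−t^p). -/
open MvPolynomial

/-- The multiplicity of the indecomposable `kG`-module `V_j` in a finite
dimensional `kG`-module `M`: `μ_j(M) = dim(Δ^{j−1}M ∩ ker Δ) − dim(Δ^{j}M ∩ ker Δ)`,
computed in `ℤ`.  Here `M` is a submodule of `k[V_m]` stable under the action. -/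
noncomputable def mult (k : Type*) [Field k] (m : ℕ) (j : ℕ)
    (M : Submodule k (MvPolynomial (Fin m) k)) : ℤ :=
  (Module.finrank k ↥(Submodule.map (delta k m ^ (j - 1)) M ⊓ LinearMap.ker (delta k m)) : ℤ) -
  (Module.finrank k ↥(Submodule.map (delta k m ^ j) M ⊓ LinearMap.ker (delta k m)) : ℤ)

section LoweringOperator

variable {k V : Type*} [Field k] [AddCommGroup V] [Module k V]
  {f : Module.End k V} {e : ℕ → V} {d : ℕ}

lemma pow_lowering_apply (hs : ∀ n < d, f (e (n + 1)) = ((n : k) + 1) • e n) (j m : ℕ)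
    (h : m + j ≤ d) : (f ^ j) (e (m + j)) = ((m + j).descFactorial j : k) • e m := by
  induction j generalizing m with
  | zero => simp
  | succ j ih =>
    rw [pow_succ, Module.End.mul_apply, ← add_assoc, hs _ (by omega), map_smul,
      ih m (by omega), smul_smul, Nat.succ_descFactorial_succ]
    push_cast
    rfl

lemma pow_lowering_apply_of_lt (h0 : f (e 0) = 0)
    (hs : ∀ n < d, f (e (n + 1)) = ((n : k) + 1) • e n) {j n : ℕ} (hn : n ≤ d) (h : n < j) :
    (f ^ j) (e n) = 0 := by
  obtain ⟨i, rfl⟩ : ∃ i, j = i + 1 + n := ⟨j - n - 1, by omega⟩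
  have := pow_lowering_apply hs n 0 (by omega)
  rw [zero_add] at this
  rw [pow_add, Module.End.mul_apply, this, map_smul, pow_succ, Module.End.mul_apply, h0]
  simp

/-- If `f e₀ = 0` and `f eₙ₊₁ = (n + 1) eₙ` in characteristic `p`, then the part of the kernel of
`f` lying in the image of `f ^ j`, `j < p`, is spanned by the `eₘ` with `p ∣ m`. -/
lemma map_pow_lowering_inf_ker (p : ℕ) [CharP k p] (hp : p.Prime)
    (he : LinearIndependent k e) (h0 : f (e 0) = 0)
    (hs : ∀ n < d, f (e (n + 1)) = ((n : k) + 1) • e n) {j : ℕ} (hj : j < p) :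
    (Submodule.span k (e '' {n | n ≤ d})).map (f ^ j) ⊓ LinearMap.ker f =
      Submodule.span k (e '' {m | p ∣ m ∧ m + j ≤ d}) := by
  apply le_antisymm
  · rintro v ⟨hv, hker⟩
    have hv' : v ∈ Submodule.span k (e '' {m | m + j ≤ d}) := by
      refine Submodule.map_span_le _ _ _ |>.2 ?_ hv
      rintro _ ⟨n, hn : n ≤ d, rfl⟩
      rcases lt_or_ge n j with h | h
      · rw [pow_lowering_apply_of_lt h0 hs hn h]
        exact zero_mem _
      · obtain ⟨m, rfl⟩ := Nat.exists_eq_add_of_le' h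
        rw [pow_lowering_apply hs j m hn]
        exact Submodule.smul_mem _ _ (Submodule.subset_span ⟨m, hn, rfl⟩)
    obtain ⟨c, hc, rfl⟩ := (Finsupp.mem_span_image_iff_linearCombination k).1 hv'
    rw [Finsupp.mem_supported] at hc
    have hsum : Finsupp.linearCombination k e c = ∑ m ∈ Finset.range (d + 1), c m • e m := by
      rw [Finsupp.linearCombination_apply]
      refine Finsupp.sum_of_support_subset _ (fun m hm => ?_) _ (by simp)
      have : m + j ≤ d := hc hm
      simp; omega
    have hf : ∑ m ∈ Finset.range d, (c (m + 1) * ((m : k) + 1)) • e m = 0 := by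
      have : f (Finsupp.linearCombination k e c) = 0 := hker
      rw [hsum, map_sum, Finset.sum_range_succ', map_smul, h0, smul_zero, add_zero] at this
      rw [← this]
      refine Finset.sum_congr rfl fun m hm => ?_
      rw [map_smul, hs m (Finset.mem_range.1 hm), smul_smul]
    have hcoeff := linearIndependent_iff'.1 he _ _ hf
    refine (Finsupp.mem_span_image_iff_linearCombination k).2 ⟨c, ?_, rfl⟩
    rw [Finsupp.mem_supported]
    intro m hm
    have hmd : m + j ≤ d := hc hm
    refine ⟨?_, hmd⟩
    cases m with
    | zero => exact dvd_zero p
    | succ m =>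
      have := (mul_eq_zero.1 (hcoeff m (Finset.mem_range.2 (by omega)))).resolve_left
        (Finsupp.mem_support_iff.1 hm)
      exact (CharP.cast_eq_zero_iff k p (m + 1)).1 (by exact_mod_cast this)
  · rw [Submodule.span_le]
    rintro _ ⟨m, ⟨hpm, hmd⟩, rfl⟩
    refine ⟨?_, ?_⟩
    · have hne : ((m + j).descFactorial j : k) ≠ 0 := by
        rw [Ne, CharP.cast_eq_zero_iff k p, Nat.descFactorial_eq_prod_range,
          hp.prime.dvd_finsetProd_iff]
        rintro ⟨i, hi, hdvd⟩
        have hi := Finset.mem_range.1 hi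
        rw [Nat.add_sub_assoc hi.le, Nat.dvd_add_right hpm] at hdvd
        have := Nat.le_of_dvd (by omega) hdvd
        omega
      refine ⟨((m + j).descFactorial j : k)⁻¹ • e (m + j),
        Submodule.smul_mem _ _ (Submodule.subset_span ⟨_, hmd, rfl⟩), ?_⟩
      rw [map_smul, pow_lowering_apply hs j m hmd, smul_smul, inv_mul_cancel₀ hne, one_smul]
    · rw [SetLike.mem_coe, LinearMap.mem_ker]
      cases m with
      | zero => exact h0
      | succ m =>
        rw [hs m (by omega)]
        have := (CharP.cast_eq_zero_iff k p (m + 1)).2 hpm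
        push_cast at this
        rw [this, zero_smul]

lemma finrank_span_image_dvd (he : LinearIndependent k e) (p j : ℕ) :
    Module.finrank k (Submodule.span k (e '' {m | p ∣ m ∧ m + j ≤ d})) =
      ((Finset.range (d + 1)).filter (fun m => p ∣ m ∧ m + j ≤ d)).card := by
  classical
  have : e '' {m | p ∣ m ∧ m + j ≤ d} =
      (((Finset.range (d + 1)).filter (fun m => p ∣ m ∧ m + j ≤ d)).image e : Finset V) := by
    ext v
    simp only [Set.mem_image, Set.mem_ofPred_eq, Finset.coe_image, Finset.coe_filter,
      Finset.mem_range]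
    refine exists_congr fun m => and_congr_left fun _ => ⟨fun h => ⟨by omega, h⟩, fun h => h.2⟩
  rw [this, finrank_span_finset_eq_card, Finset.card_image_of_injective _ he.injective]
  rw [← this]
  exact he.linearIndepOn_id.mono (Set.image_subset_range _ _)

end LoweringOperator

lemma card_filter_dvd_sub (p d j : ℕ) (hj : j < p) :
    (((Finset.range (d + 1)).filter (fun m => p ∣ m ∧ m + j ≤ d)).card : ℤ) -
      ((Finset.range (d + 1)).filter (fun m => p ∣ m ∧ m + (j + 1) ≤ d)).card =
      if d % p = j then 1 else 0 := by
  have hmod : ∀ m, p ∣ m → m + j = d → d % p = j := by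
    rintro _ ⟨q, rfl⟩ rfl
    rw [Nat.mul_add_mod, Nat.mod_eq_of_lt hj]
  split_ifs with h
  · have : (Finset.range (d + 1)).filter (fun m => p ∣ m ∧ m + j ≤ d) =
        insert (d - j)
          ((Finset.range (d + 1)).filter (fun m => p ∣ m ∧ m + (j + 1) ≤ d)) := by
      have hjd : j ≤ d := h ▸ Nat.mod_le d p
      have hdvd : p ∣ d - j := h ▸ Nat.dvd_sub_mod d
      ext m
      simp only [Finset.mem_filter, Finset.mem_range, Finset.mem_insert]
      constructor
      · rintro ⟨h1, h2, h3⟩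
        by_cases hm : m = d - j
        · exact Or.inl hm
        · exact Or.inr ⟨h1, h2, by omega⟩
      · rintro (rfl | ⟨h1, h2, h3⟩)
        · exact ⟨by omega, hdvd, by omega⟩
        · exact ⟨h1, h2, by omega⟩
    rw [this, Finset.card_insert_of_notMem]
    · push_cast; ring
    · have hjd : j ≤ d := h ▸ Nat.mod_le d p
      simp only [Finset.mem_filter, not_and]
      intros
      omega
  · rw [sub_eq_zero]
    congr 2
    refine Finset.filter_congr fun m _ => and_congr_right fun hm => ?_
    have hne : m + j ≠ d := fun h' => h (hmod m hm h')
    omega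

section FallingFactorial

variable (k : Type*) [CommRing k]

/-- The homogeneous falling factorial `∏_{i < n} (x₁ - i x₂)`. -/
noncomputable def homFalling (n : ℕ) : MvPolynomial (Fin 2) k :=
  ∏ i ∈ Finset.range n, (X 0 - (i : MvPolynomial (Fin 2) k) * X 1)

lemma homFalling_succ (n : ℕ) :
    homFalling k (n + 1) = homFalling k n * (X 0 - (n : MvPolynomial (Fin 2) k) * X 1) :=
  Finset.prod_range_succ _ _

lemma sigmaHom_X_zero : sigmaHom k 2 (X 0) = X 0 + X 1 := by
  simp [sigmaHom]

lemma sigmaHom_X_one : sigmaHom k 2 (X 1) = X 1 := by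
  simp [sigmaHom]

lemma sigmaHom_homFalling_succ (n : ℕ) :
    sigmaHom k 2 (homFalling k (n + 1)) = (X 0 + X 1) * homFalling k n := by
  induction n with
  | zero => simp [homFalling, sigmaHom_X_zero]
  | succ n ih =>
    rw [homFalling_succ, map_mul, ih, map_sub, map_mul, map_natCast, sigmaHom_X_zero,
      sigmaHom_X_one, homFalling_succ]
    push_cast
    ring

/-- The elements `∏_{i < n} (x₁ - i x₂) x₂^{d - n}`, which for `n ≤ d` form a basis of the
binary forms of degree `d`. -/
noncomputable def fallingForm (d n : ℕ) : MvPolynomial (Fin 2) k :=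
  homFalling k n * X 1 ^ (d - n)

lemma delta_fallingForm_zero (d : ℕ) : delta k 2 (fallingForm k d 0) = 0 := by
  simp [delta, fallingForm, homFalling, sigmaHom_X_one]

lemma delta_fallingForm_succ {d n : ℕ} (h : n < d) :
    delta k 2 (fallingForm k d (n + 1)) = ((n : k) + 1) • fallingForm k d n := by
  obtain ⟨c, rfl⟩ : ∃ c, d = n + 1 + c := ⟨d - n - 1, by omega⟩
  have h1 : n + 1 + c - (n + 1) = c := by omega
  have h2 : n + 1 + c - n = c + 1 := by omega
  simp only [delta, fallingForm, LinearMap.sub_apply, AlgHom.toLinearMap_apply,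
    LinearMap.id_apply, map_mul, map_pow, sigmaHom_homFalling_succ, sigmaHom_X_one, h1, h2,
    MvPolynomial.smul_eq_C_mul, map_add, map_natCast, map_one]
  rw [homFalling_succ]
  ring

lemma isHomogeneous_homFalling (n : ℕ) : (homFalling k n).IsHomogeneous n := by
  induction n with
  | zero => simpa [homFalling] using isHomogeneous_one (Fin 2) k
  | succ n ih =>
    rw [homFalling_succ]
    refine ih.mul ((isHomogeneous_X _ _).sub ?_)
    rw [← map_natCast (C : k →+* MvPolynomial (Fin 2) k)]
    exact isHomogeneous_C_mul_X _ _

lemma X_zero_mul_mem_span_fallingForm {d : ℕ} {v : MvPolynomial (Fin 2) k}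
    (hv : v ∈ Submodule.span k (fallingForm k d '' {n | n ≤ d})) :
    X 0 * v ∈ Submodule.span k (fallingForm k (d + 1) '' {n | n ≤ d + 1}) := by
  refine (Submodule.map_span_le (LinearMap.mulLeft k (X 0)) _ _).2 ?_
    (Submodule.mem_map_of_mem hv)
  rintro _ ⟨n, hn : n ≤ d, rfl⟩
  have : LinearMap.mulLeft k (X 0) (fallingForm k d n) =
      fallingForm k (d + 1) (n + 1) + (n : k) • fallingForm k (d + 1) n := by
    have h1 : d + 1 - (n + 1) = d - n := by omega
    have h2 : d + 1 - n = d - n + 1 := by omega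
    simp only [LinearMap.mulLeft_apply, fallingForm, h1, h2, homFalling_succ,
      MvPolynomial.smul_eq_C_mul, map_natCast]
    ring
  rw [this]
  exact add_mem (Submodule.subset_span ⟨_, Nat.succ_le_succ hn, rfl⟩)
    (Submodule.smul_mem _ _ (Submodule.subset_span ⟨_, hn.trans d.le_succ, rfl⟩))

lemma X_pow_mul_X_pow_mem_span_fallingForm (a b : ℕ) :
    (X 0 ^ a * X 1 ^ b : MvPolynomial (Fin 2) k) ∈
      Submodule.span k (fallingForm k (a + b) '' {n | n ≤ a + b}) := by
  induction a with
  | zero => exact Submodule.subset_span ⟨0, by simp, by simp [fallingForm, homFalling]⟩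
  | succ a ih =>
    rw [pow_succ', mul_assoc, Nat.add_right_comm]
    exact X_zero_mul_mem_span_fallingForm k ih

lemma homogeneousSubmodule_eq_span_fallingForm (d : ℕ) :
    homogeneousSubmodule (Fin 2) k d =
      Submodule.span k (fallingForm k d '' {n | n ≤ d}) := by
  apply le_antisymm
  · intro v hv
    rw [mem_homogeneousSubmodule] at hv
    rw [v.as_sum]
    refine Submodule.sum_mem _ fun s hs => ?_
    have hdeg : s 0 + s 1 = d := by
      have := hv (mem_support_iff.1 hs)
      simpa [Finsupp.weight_apply, Finsupp.sum_fintype] using this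
    rw [monomial_eq, Finsupp.prod_fintype _ _ (by simp), Fin.prod_univ_two,
      ← MvPolynomial.smul_eq_C_mul, ← hdeg]
    exact Submodule.smul_mem _ _ (X_pow_mul_X_pow_mem_span_fallingForm k _ _)
  · rw [Submodule.span_le]
    rintro _ ⟨n, hn : n ≤ d, rfl⟩
    have := (isHomogeneous_homFalling k n).mul ((isHomogeneous_X k (1 : Fin 2)).pow (d - n))
    rwa [one_mul, Nat.add_sub_cancel' hn] at this

lemma linearIndependent_fallingForm (k : Type*) [Field k] (d : ℕ) :
    LinearIndependent k (fallingForm k d) := by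
  let φ : MvPolynomial (Fin 2) k →ₐ[k] Polynomial k := aeval ![Polynomial.X, 1]
  have hφ (n : ℕ) : φ (fallingForm k d n) = descPochhammer k n := by
    have : φ (homFalling k n) = descPochhammer k n := by
      induction n with
      | zero => simp [homFalling]
      | succ n ih => simp [homFalling_succ, ih, descPochhammer_succ_right, φ]
    simp [fallingForm, this, φ]
  refine LinearIndependent.of_comp φ.toLinearMap ?_
  let S : Polynomial.Sequence k :=
    ⟨fun n => descPochhammer k n, fun n => by
      rw [Polynomial.degree_eq_natDegree (monic_descPochhammer k n).ne_zero,
        descPochhammer_natDegree]⟩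
  have hS : LinearIndependent k fun n => descPochhammer k n := S.linearIndependent
  exact (funext hφ : φ.toLinearMap ∘ fallingForm k d = fun n => descPochhammer k n) ▸ hS

end FallingFactorial

/-- For `1 ≤ j ≤ p−1`, the multiplicity of `V_j` in the degree-`d` homogeneous
component `k[V_2]_d` is `1` if `d ≡ j−1 (mod p)` and `0` otherwise;
equivalently `H_j(k[V_2],t) = t^{j−1}/(1−t^p)`. -/
theorem statement5 (p : ℕ) (hp : p.Prime) (k : Type*) [Field k] [CharP k p]
    (j : ℕ) (hj1 : 1 ≤ j) (hjp : j ≤ p - 1) (d : ℕ) :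
    mult k 2 j (homogeneousSubmodule (Fin 2) k d) =
      if d % p = j - 1 then 1 else 0 := by
  obtain ⟨i, rfl⟩ := Nat.exists_eq_add_of_le' hj1
  have hli := linearIndependent_fallingForm k d
  have h0 := delta_fallingForm_zero k d
  have hs : ∀ n < d, _ := fun n hn => delta_fallingForm_succ k (d := d) (n := n) hn
  rw [mult, homogeneousSubmodule_eq_span_fallingForm, Nat.add_sub_cancel,
    map_pow_lowering_inf_ker p hp hli h0 hs (by omega),
    map_pow_lowering_inf_ker p hp hli h0 hs (by omega),
    finrank_span_image_dvd hli, finrank_span_image_dvd hli]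
  exact card_filter_dvd_sub p d i (by omega)
end

section
/- Let p be an odd prime. For every even k with 1 ≤ k ≤ p−1 and every degree d ≥ 0, the multiplicity of the indecomposable module V_k in the degree-d homogeneous component k[V_3]_d is zero. -/
open MvPolynomial

noncomputable section

variable {k : Type*} [Field k]

lemma delta_apply {m : ℕ} (f : MvPolynomial (Fin m) k) : delta k m f = sigmaHom k m f - f := rfl

@[simp] lemma sigmaHom_X0 :
    sigmaHom k 3 (X 0) = X 0 + X 1 := by simp [sigmaHom]

@[simp] lemma sigmaHom_X1 :
    sigmaHom k 3 (X 1) = X 1 + X 2 := by simp [sigmaHom]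

@[simp] lemma sigmaHom_X2 :
    sigmaHom k 3 (X 2) = X 2 := by simp [sigmaHom]

@[simp] lemma sigmaHom_C (m : ℕ) (c : k) : sigmaHom k m (C c) = C c := (sigmaHom k m).commutes c

variable (k) in
/-- The linear form `x₂ - x₃ / 2`, on which the reflection acts by `-1`. -/
def oddForm : MvPolynomial (Fin 3) k := X 1 - C 2⁻¹ * X 2

variable (k) in
/-- The invariant quadratic form. -/
def quadForm : MvPolynomial (Fin 3) k := oddForm k ^ 2 - 2 * X 2 * X 0

variable (k) in
/-- The reflection fixing `x₁`, `x₃` and negating `x₂ - x₃ / 2`; it conjugates `σ` to `σ⁻¹`. -/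
def reflHom : MvPolynomial (Fin 3) k →ₐ[k] MvPolynomial (Fin 3) k :=
  aeval ![X 0, X 2 - X 1, X 2]

@[simp] lemma reflHom_X0 : reflHom k (X 0) = X 0 := by simp [reflHom]
@[simp] lemma reflHom_X1 : reflHom k (X 1) = X 2 - X 1 := by simp [reflHom]
@[simp] lemma reflHom_X2 : reflHom k (X 2) = X 2 := by simp [reflHom]
@[simp] lemma reflHom_C (c : k) : reflHom k (C c) = C c := (reflHom k).commutes c

lemma two_mul_C_half (h2 : (2 : k) ≠ 0) :
    (2 : MvPolynomial (Fin 3) k) * C 2⁻¹ = 1 := by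
  rw [show (2 : MvPolynomial (Fin 3) k) = C 2 from (map_ofNat C 2).symm, ← C_mul,
    mul_inv_cancel₀ h2, C_1]

@[simp] lemma sigmaHom_oddForm : sigmaHom k 3 (oddForm k) = oddForm k + X 2 := by
  simp [oddForm]; ring

lemma sigmaHom_X0_eq_oddForm :
    sigmaHom k 3 (X 0) = (X 0 + C 2⁻¹ * X 2) + oddForm k := by
  simp [oddForm]

lemma reflHom_oddForm (h2 : (2 : k) ≠ 0) : reflHom k (oddForm k) = -oddForm k := by
  simp only [oddForm, map_sub, map_mul, reflHom_X1, reflHom_X2, reflHom_C]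
  linear_combination (-X 2) * two_mul_C_half h2

lemma sigmaHom_quadForm (h2 : (2 : k) ≠ 0) : sigmaHom k 3 (quadForm k) = quadForm k := by
  simp only [quadForm, map_sub, map_mul, map_pow, sigmaHom_oddForm, sigmaHom_X2, map_ofNat,
    sigmaHom_X0_eq_oddForm]
  linear_combination (-(X 2)^2) * two_mul_C_half h2

lemma reflHom_quadForm (h2 : (2 : k) ≠ 0) : reflHom k (quadForm k) = quadForm k := by
  simp only [quadForm, map_sub, map_mul, map_pow, reflHom_oddForm h2, reflHom_X0, reflHom_X2,
    map_ofNat, neg_sq]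

lemma sigmaHom_reflHom_sigmaHom (f : MvPolynomial (Fin 3) k) :
    sigmaHom k 3 (reflHom k (sigmaHom k 3 f)) = reflHom k f := by
  have : ((sigmaHom k 3).comp (reflHom k)).comp (sigmaHom k 3) = reflHom k := by
    ext i : 1
    fin_cases i <;> simp [sub_eq_neg_add]
  exact DFunLike.congr_fun this f

lemma reflHom_reflHom (f : MvPolynomial (Fin 3) k) : reflHom k (reflHom k f) = f := by
  have : (reflHom k).comp (reflHom k) = AlgHom.id k _ := by
    ext i : 1
    fin_cases i <;> simp
  exact DFunLike.congr_fun this f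

/-! ### The operator `Δ` -/

lemma delta_pow_mul_of_fixed {m : ℕ} {v : MvPolynomial (Fin m) k} (hv : sigmaHom k m v = v)
    (n : ℕ) (f : MvPolynomial (Fin m) k) :
    (delta k m ^ n) (v * f) = v * (delta k m ^ n) f := by
  induction n generalizing f with
  | zero => simp
  | succ n ih =>
    rw [pow_succ, Module.End.mul_apply, Module.End.mul_apply, ← ih, delta_apply, delta_apply,
      map_mul, hv, mul_sub]

lemma sigmaHom_eq_of_delta_eq_zero {m : ℕ} {w : MvPolynomial (Fin m) k} (h : delta k m w = 0) :
    sigmaHom k m w = w := sub_eq_zero.1 h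

lemma iterate_sigmaHom_oddForm (n : ℕ) :
    (sigmaHom k 3)^[n] (oddForm k) = oddForm k + (n : MvPolynomial (Fin 3) k) * X 2 := by
  induction n with
  | zero => simp
  | succ n ih => rw [Function.iterate_succ_apply', ih]; simp; ring

lemma two_mul_iterate_sigmaHom_X0 (h2 : (2 : k) ≠ 0) (n : ℕ) :
    2 * (sigmaHom k 3)^[n] (X 0) =
      2 * X 0 + 2 * (n : MvPolynomial (Fin 3) k) * oddForm k +
        (n : MvPolynomial (Fin 3) k) ^ 2 * X 2 := by
  induction n with
  | zero => simp
  | succ n ih =>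
    rw [Function.iterate_succ_apply']
    have := congrArg (sigmaHom k 3) ih
    simp only [map_mul, map_ofNat, map_add, map_pow, map_natCast, sigmaHom_oddForm, sigmaHom_X2,
      sigmaHom_X0_eq_oddForm] at this
    rw [this]
    push_cast
    linear_combination (X 2) * two_mul_C_half h2

variable {p : ℕ} [CharP k p]

lemma two_ne_zero_of_odd_char (hp : p.Prime) (hodd : Odd p) : (2 : k) ≠ 0 := by
  intro h
  have := (CharP.cast_eq_zero_iff k p 2).1 (by exact_mod_cast h)
  have := (Nat.prime_dvd_prime_iff_eq hp Nat.prime_two).1 this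
  subst this
  exact absurd hodd (by decide)

lemma iterate_sigmaHom_eq_pow (n : ℕ) (f : MvPolynomial (Fin 3) k) :
    (sigmaHom k 3)^[n] f = ((sigmaHom k 3).toLinearMap ^ n) f := by
  rw [Module.End.pow_apply]; rfl

lemma iterate_char_sigmaHom (hp : p.Prime) (hodd : Odd p) (f : MvPolynomial (Fin 3) k) :
    (sigmaHom k 3)^[p] f = f := by
  have h2 : (2 : k) ≠ 0 := two_ne_zero_of_odd_char hp hodd
  have h0 : ((p : ℕ) : MvPolynomial (Fin 3) k) = 0 := CharP.cast_eq_zero _ p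
  have hB : (sigmaHom k 3)^[p] (oddForm k) = oddForm k := by
    rw [iterate_sigmaHom_oddForm, h0, zero_mul, add_zero]
  have hX2 (n : ℕ) : (sigmaHom k 3)^[n] (X 2) = X 2 :=
    Function.iterate_fixed sigmaHom_X2 n
  have hcoe : ∀ g, (sigmaHom k 3)^[p] g = (sigmaHom k 3 ^ p) g := fun g => by
    rw [AlgHom.coe_pow]
  have : sigmaHom k 3 ^ p = AlgHom.id k _ := by
    ext i : 1
    fin_cases i
    · have := two_mul_iterate_sigmaHom_X0 h2 p
      rw [h0, hcoe] at this
      have h2' : (2 : MvPolynomial (Fin 3) k) ≠ 0 := fun h => by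
        have := two_mul_C_half h2
        rw [h, zero_mul] at this
        exact zero_ne_one this
      exact mul_left_cancel₀ h2' (by simpa using this)
    · rw [hcoe] at hB
      have hX := hX2 p
      rw [hcoe] at hX
      have h1 : (sigmaHom k 3 ^ p) (C 2⁻¹) = C 2⁻¹ := (sigmaHom k 3 ^ p).commutes _
      rw [oddForm, map_sub, map_mul, hX, h1] at hB
      simpa using hB
    · have := hX2 p
      rw [hcoe] at this
      simpa using this
  rw [hcoe, this, AlgHom.id_apply]

lemma delta_pow_char (hp : p.Prime) (hodd : Odd p) : delta k 3 ^ p = 0 := by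
  have := Fact.mk hp
  have h : (Polynomial.X - 1 : Polynomial k) ^ p = Polynomial.X ^ p - 1 := by
    rw [sub_pow_char, one_pow]
  have := congrArg (Polynomial.aeval (sigmaHom k 3).toLinearMap) h
  simp only [map_pow, map_sub, Polynomial.aeval_X, map_one] at this
  refine LinearMap.ext fun f => ?_
  have hf := LinearMap.congr_fun this f
  rw [LinearMap.sub_apply, ← iterate_sigmaHom_eq_pow, iterate_char_sigmaHom hp hodd] at hf
  simpa [delta, Module.End.one_eq_id] using hf

lemma delta_pow_char_sub_one (hp : p.Prime) (f : MvPolynomial (Fin 3) k) :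
    (delta k 3 ^ (p - 1)) f = ∑ i ∈ Finset.range p, (sigmaHom k 3)^[i] f := by
  have := Fact.mk hp
  have h : (Polynomial.X - 1 : Polynomial k) ^ (p - 1) =
      ∑ i ∈ Finset.range p, Polynomial.X ^ i := by
    apply mul_left_cancel₀ (Polynomial.X_sub_C_ne_zero (1 : k))
    rw [Polynomial.C_1, mul_geom_sum, ← pow_succ', Nat.sub_add_cancel hp.one_le, sub_pow_char,
      one_pow]
  have := congrArg (Polynomial.aeval (sigmaHom k 3).toLinearMap) h
  simp only [map_pow, map_sub, Polynomial.aeval_X, map_one, map_sum] at this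
  simp only [iterate_sigmaHom_eq_pow]
  rw [← LinearMap.sum_apply, ← this]
  rfl

lemma delta_pow_iterate_sigmaHom (m n i : ℕ) (f : MvPolynomial (Fin m) k) :
    (delta k m ^ n) ((sigmaHom k m)^[i] f) = (sigmaHom k m)^[i] ((delta k m ^ n) f) := by
  rw [Module.End.pow_apply, Module.End.pow_apply]
  refine (Function.Commute.iterate_iterate (fun g => ?_) n i) f
  rw [delta_apply, delta_apply, map_sub]

/-- `Δ` and the reflection satisfy `Δ τ = -τ σ⁻¹ Δ`. -/
lemma delta_pow_reflHom_iterate (n : ℕ) (f : MvPolynomial (Fin 3) k) :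
    (delta k 3 ^ n) (reflHom k ((sigmaHom k 3)^[n] f)) =
      (-1) ^ n * reflHom k ((delta k 3 ^ n) f) := by
  induction n generalizing f with
  | zero => simp
  | succ n ih =>
    have hstep (g : MvPolynomial (Fin 3) k) :
        delta k 3 (reflHom k (sigmaHom k 3 g)) = -reflHom k (delta k 3 g) := by
      rw [delta_apply, delta_apply, sigmaHom_reflHom_sigmaHom, map_sub, neg_sub]
    have hcomm : delta k 3 ((sigmaHom k 3)^[n] f) = (sigmaHom k 3)^[n] (delta k 3 f) := by
      simpa using delta_pow_iterate_sigmaHom 3 1 n f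
    rw [pow_succ, Module.End.mul_apply, Module.End.mul_apply, Function.iterate_succ_apply', hstep,
      map_neg, hcomm, ih]
    ring

/-- `Δ ^ n` commutes with the reflection up to the sign `(-1) ^ n` on elements whose image under
`Δ ^ n` is invariant. -/
lemma delta_pow_reflHom (hp : p.Prime) (hodd : Odd p) {n : ℕ} {f : MvPolynomial (Fin 3) k}
    (h : sigmaHom k 3 ((delta k 3 ^ n) f) = (delta k 3 ^ n) f) :
    (delta k 3 ^ n) (reflHom k f) = (-1) ^ n * reflHom k ((delta k 3 ^ n) f) := by
  have hf : (sigmaHom k 3)^[n] ((sigmaHom k 3)^[(p - 1) * n] f) = f := by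
    rw [← Function.iterate_add_apply, show n + (p - 1) * n = p * n by
      obtain ⟨q, rfl⟩ := Nat.exists_eq_add_of_le hp.one_le
      simp; ring, Function.iterate_mul]
    exact Function.iterate_fixed (iterate_char_sigmaHom hp hodd f) n
  have := delta_pow_reflHom_iterate n ((sigmaHom k 3)^[(p - 1) * n] f)
  rwa [hf, delta_pow_iterate_sigmaHom, Function.iterate_fixed h] at this

section Degree

variable {R A : Type*} [CommRing R] [CommRing A] [Algebra R A] {q : Polynomial R} {m : ℕ}

lemma degree_C_mul_lt (a : R) (h : q.degree < (m : WithBot ℕ)) :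
    (Polynomial.C a * q).degree < (m : WithBot ℕ) := by
  rw [← Polynomial.smul_eq_C_mul]
  exact (Polynomial.degree_smul_le a q).trans_lt h

lemma degree_X_mul_lt (h : q.degree < (m : WithBot ℕ)) :
    (Polynomial.X * q).degree < ((m + 1 : ℕ) : WithBot ℕ) := by
  rw [Polynomial.degree_lt_iff_coeff_zero] at h ⊢
  rintro (_ | n) hn
  · omega
  · rw [Polynomial.coeff_X_mul]
    exact h n (by omega)

lemma degree_add_lt {r : Polynomial R} (hq : q.degree < (m : WithBot ℕ))
    (hr : r.degree < (m : WithBot ℕ)) : (q + r).degree < (m : WithBot ℕ) :=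
  (Polynomial.degree_add_le q r).trans_lt (max_lt hq hr)

lemma degree_X_pow_lt (m : ℕ) :
    (Polynomial.X ^ m : Polynomial R).degree < ((m + 1 : ℕ) : WithBot ℕ) :=
  (Polynomial.degree_X_pow_le m).trans_lt (WithBot.coe_lt_coe.2 m.lt_succ_self)

lemma degree_lt_of_degree_lt_of_le {n : ℕ} (h : q.degree < (m : WithBot ℕ)) (hmn : m ≤ n) :
    q.degree < (n : WithBot ℕ) :=
  h.trans_le (WithBot.coe_le_coe.2 hmn)

/-- If `b ^ 2` is affine in `x`, then `(x + c + b) ^ (n + 1)` is the sum of a monic polynomial of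
degree `n + 1` in `x` and `b` times a polynomial of degree `n` with leading coefficient `n + 1`. -/
lemma exists_add_pow_eq_aeval {x b : A} {c d e : R}
    (hb : b ^ 2 = algebraMap R A d + algebraMap R A e * x) (n : ℕ) :
    ∃ q r : Polynomial R, q.degree < ((n + 1 : ℕ) : WithBot ℕ) ∧ r.degree < (n : WithBot ℕ) ∧
      (x + algebraMap R A c + b) ^ (n + 1) = Polynomial.aeval x (Polynomial.X ^ (n + 1) + q) +
        b * Polynomial.aeval x (((n + 1 : ℕ) : Polynomial R) * Polynomial.X ^ n + r) := by
  induction n with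
  | zero =>
    refine ⟨Polynomial.C c, 0, ?_, by simp, ?_⟩
    · exact Polynomial.degree_C_le.trans_lt (by norm_num)
    · simp
  | succ n ih =>
    obtain ⟨q, r, hq, hr, h⟩ := ih
    have hL : (((n + 1 : ℕ) : Polynomial R) * Polynomial.X ^ n + r).degree <
        ((n + 1 : ℕ) : WithBot ℕ) := by
      refine degree_add_lt ?_ (degree_lt_of_degree_lt_of_le hr n.le_succ)
      rw [← map_natCast Polynomial.C]
      exact degree_C_mul_lt _ (degree_X_pow_lt n)
    obtain ⟨L, hLdef⟩ : ∃ L, L = ((n + 1 : ℕ) : Polynomial R) * Polynomial.X ^ n + r := ⟨_, rfl⟩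
    rw [← hLdef] at hL h
    refine ⟨Polynomial.X * q + Polynomial.C c * (Polynomial.X ^ (n + 1) + q) +
      (Polynomial.C d * L + Polynomial.C e * (Polynomial.X * L)),
      Polynomial.X * r + Polynomial.C c * L + q, ?_, ?_, ?_⟩
    · have hq' := degree_lt_of_degree_lt_of_le hq (n + 1).le_succ
      exact degree_add_lt
        (degree_add_lt (degree_X_mul_lt hq)
          (degree_C_mul_lt _ (degree_add_lt (degree_X_pow_lt _) hq')))
        (degree_add_lt (degree_C_mul_lt _ (degree_lt_of_degree_lt_of_le hL (n + 1).le_succ))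
          (degree_C_mul_lt _ (degree_X_mul_lt hL)))
    · exact degree_add_lt (degree_add_lt (degree_X_mul_lt hr) (degree_C_mul_lt _ hL)) hq
    · have hY : ((n + 1 + 1 : ℕ) : Polynomial R) * Polynomial.X ^ (n + 1) +
          (Polynomial.X * r + Polynomial.C c * L + q) =
          (Polynomial.X + Polynomial.C c) * L + (Polynomial.X ^ (n + 1) + q) := by
        rw [hLdef]
        push_cast
        ring
      rw [hY, pow_succ, h]
      simp only [map_add, map_mul, map_pow, Polynomial.aeval_X, Polynomial.aeval_C]
      linear_combination (Polynomial.aeval x L) * hb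

/-- If `a` is affine in `x` with constant term `d`, then `(a ^ (n + 1) - d ^ (n + 1)) / (a - d)` is
a polynomial of degree at most `n` in `x`. -/
lemma exists_aeval_mul_eq_pow_sub_pow {x a : A} {d e : R}
    (ha : a = algebraMap R A d + algebraMap R A e * x) (n : ℕ) :
    ∃ s : Polynomial R, s.degree < ((n + 1 : ℕ) : WithBot ℕ) ∧
      Polynomial.aeval x s * (algebraMap R A e * x) = a ^ (n + 1) - algebraMap R A d ^ (n + 1) := by
  induction n with
  | zero => exact ⟨1, Polynomial.degree_one_le.trans_lt (by norm_num), by simp [ha]⟩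
  | succ n ih =>
    obtain ⟨s, hs, h⟩ := ih
    have hs' := degree_lt_of_degree_lt_of_le hs (n + 1).le_succ
    refine ⟨Polynomial.C d * s + Polynomial.C e * (Polynomial.X * s) + Polynomial.C (d ^ (n + 1)),
      degree_add_lt (degree_add_lt (degree_C_mul_lt _ hs')
        (degree_C_mul_lt _ (degree_X_mul_lt hs))) (Polynomial.degree_C_le.trans_lt ?_), ?_⟩
    · exact WithBot.coe_lt_coe.2 (Nat.succ_pos _)
    · simp only [map_add, map_mul, map_pow, Polynomial.aeval_X, Polynomial.aeval_C]
      subst ha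
      linear_combination (algebraMap R A d + algebraMap R A e * x) * h

end Degree

/-! ### Odd elements modulo the image of `Δ` -/

variable (k) in
/-- The subalgebra of polynomials fixed by both `σ` and the reflection. -/
def dihedralInvariants : Subalgebra k (MvPolynomial (Fin 3) k) :=
  AlgHom.equalizer (sigmaHom k 3) (AlgHom.id k _) ⊓ AlgHom.equalizer (reflHom k) (AlgHom.id k _)

lemma mem_dihedralInvariants {f : MvPolynomial (Fin 3) k} :
    f ∈ dihedralInvariants k ↔ sigmaHom k 3 f = f ∧ reflHom k f = f := Iff.rfl

variable (k) in
/-- Evaluation at `x₁` of polynomials with coefficients in the dihedral invariants. -/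
def evalX0 : Polynomial (dihedralInvariants k) →ₐ[dihedralInvariants k] MvPolynomial (Fin 3) k :=
  Polynomial.aeval (X 0)

@[simp] lemma evalX0_X : evalX0 k Polynomial.X = X 0 := Polynomial.aeval_X _

@[simp] lemma evalX0_C (v : dihedralInvariants k) : evalX0 k (Polynomial.C v) = v :=
  Polynomial.aeval_C _ _

lemma reflHom_evalX0 (q : Polynomial (dihedralInvariants k)) :
    reflHom k (evalX0 k q) = evalX0 k q := by
  induction q using Polynomial.induction_on' with
  | add p q hp hq => rw [map_add, map_add, hp, hq]
  | monomial n v =>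
    rw [← Polynomial.C_mul_X_pow_eq_monomial, map_mul, map_pow, evalX0_C, evalX0_X, map_mul,
      map_pow, reflHom_X0, (mem_dihedralInvariants.1 v.2).2]

variable (k) in
/-- The variable `x₃` as a dihedral invariant. -/
def invX2 : dihedralInvariants k :=
  ⟨X 2, mem_dihedralInvariants.2 ⟨sigmaHom_X2, reflHom_X2⟩⟩

/-- The invariant quadratic form as a dihedral invariant. -/
def invQuad (h2 : (2 : k) ≠ 0) : dihedralInvariants k :=
  ⟨quadForm k, mem_dihedralInvariants.2 ⟨sigmaHom_quadForm h2, reflHom_quadForm h2⟩⟩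

variable (k) in
/-- The constant `1 / 2` as a dihedral invariant. -/
def invHalf : dihedralInvariants k := algebraMap k _ 2⁻¹

@[simp] lemma coe_invX2 : (invX2 k : MvPolynomial (Fin 3) k) = X 2 := rfl

lemma oddForm_sq (h2 : (2 : k) ≠ 0) :
    oddForm k ^ 2 = algebraMap (dihedralInvariants k) _ (invQuad h2) +
      algebraMap (dihedralInvariants k) _ (2 * invX2 k) * X 0 := by
  change _ = quadForm k + 2 * X 2 * X 0
  rw [quadForm]
  ring

lemma exists_eq_evalX0_add_oddForm_mul (h2 : (2 : k) ≠ 0) (f : MvPolynomial (Fin 3) k) :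
    ∃ q r, f = evalX0 k q + oddForm k * evalX0 k r := by
  induction f using MvPolynomial.induction_on with
  | C a => exact ⟨Polynomial.C (algebraMap k _ a), 0, by
      rw [evalX0_C, map_zero, mul_zero, add_zero]
      rfl⟩
  | add f g hf hg =>
    obtain ⟨q, r, rfl⟩ := hf
    obtain ⟨q', r', rfl⟩ := hg
    exact ⟨q + q', r + r', by simp only [map_add]; ring⟩
  | mul_X f i hf =>
    obtain ⟨q, r, rfl⟩ := hf
    fin_cases i
    · exact ⟨q * Polynomial.X, r * Polynomial.X, by simp; ring⟩
    · obtain ⟨c, hc⟩ : ∃ c, evalX0 k c = C 2⁻¹ * X 2 :=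
        ⟨Polynomial.C (invHalf k * invX2 k), evalX0_C _⟩
      obtain ⟨s, hs⟩ : ∃ s, evalX0 k s = oddForm k ^ 2 := by
        refine ⟨Polynomial.C (invQuad h2) + Polynomial.C (2 * invX2 k) * Polynomial.X, ?_⟩
        rw [oddForm_sq h2, map_add, map_mul, evalX0_C, evalX0_C, evalX0_X]
        rfl
      refine ⟨q * c + r * s, q + r * c, ?_⟩
      have h1 : (X 1 : MvPolynomial (Fin 3) k) = oddForm k + C 2⁻¹ * X 2 := by simp [oddForm]
      rw [map_add, map_add, map_mul, map_mul, map_mul, hc, hs, Fin.mk_one, h1]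
      ring
    · exact ⟨q * Polynomial.C (invX2 k), r * Polynomial.C (invX2 k), by simp; ring⟩

lemma exists_eq_oddForm_mul_evalX0 (h2 : (2 : k) ≠ 0) {f : MvPolynomial (Fin 3) k}
    (hf : reflHom k f = -f) : ∃ r, f = oddForm k * evalX0 k r := by
  obtain ⟨q, r, rfl⟩ := exists_eq_evalX0_add_oddForm_mul h2 f
  refine ⟨r, ?_⟩
  rw [map_add, map_mul, reflHom_oddForm h2, reflHom_evalX0, reflHom_evalX0] at hf
  linear_combination (C 2⁻¹) * hf - (evalX0 k q) * two_mul_C_half h2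

variable (k) in
/-- The elements congruent modulo the image of `Δ` to a `σ`-invariant multiple of `y`. -/
def imageDeltaAdd (y : MvPolynomial (Fin 3) k) :
    Submodule (dihedralInvariants k) (MvPolynomial (Fin 3) k) where
  carrier := {f | ∃ g v, sigmaHom k 3 v = v ∧ f = delta k 3 g + v * y}
  zero_mem' := ⟨0, 0, by simp⟩
  add_mem' := by
    rintro _ _ ⟨g, v, hv, rfl⟩ ⟨g', v', hv', rfl⟩
    exact ⟨g + g', v + v', by rw [map_add, hv, hv'], by rw [map_add]; ring⟩
  smul_mem' := by
    rintro c _ ⟨g, v, hv, rfl⟩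
    have hc := (mem_dihedralInvariants.1 c.2).1
    refine ⟨c * g, c * v, by rw [map_mul, hc, hv], ?_⟩
    have := delta_pow_mul_of_fixed hc 1 g
    rw [pow_one] at this
    rw [this, Subalgebra.smul_def, smul_eq_mul]
    ring

lemma mul_evalX0_mem {Q : Submodule (dihedralInvariants k) (MvPolynomial (Fin 3) k)}
    {b : MvPolynomial (Fin 3) k} {n : ℕ} (h : ∀ i < n, b * X 0 ^ i ∈ Q)
    {q : Polynomial (dihedralInvariants k)} (hq : q.degree < n) : b * evalX0 k q ∈ Q := by
  rw [evalX0, Polynomial.aeval_def, Polynomial.eval₂_eq_sum, Polynomial.sum_def, Finset.mul_sum]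
  refine Q.sum_mem fun i hi => ?_
  have hin : i < n := by
    exact_mod_cast (Polynomial.le_degree_of_mem_supp i hi).trans_lt hq
  have := Q.smul_mem (q.coeff i) (h i hin)
  rw [Algebra.smul_def] at this
  convert this using 1
  ring

lemma exists_add_oddForm_pow (h2 : (2 : k) ≠ 0) (n : ℕ) :
    ∃ q r : Polynomial (dihedralInvariants k), q.degree < ((n + 1 : ℕ) : WithBot ℕ) ∧
      r.degree < (n : WithBot ℕ) ∧
      (X 0 + C 2⁻¹ * X 2 + oddForm k) ^ (n + 1) = evalX0 k (Polynomial.X ^ (n + 1) + q) +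
        oddForm k * evalX0 k (((n + 1 : ℕ) : Polynomial (dihedralInvariants k)) * Polynomial.X ^ n
          + r) :=
  exists_add_pow_eq_aeval (c := invHalf k * invX2 k) (oddForm_sq h2) n

lemma reflHom_delta_mem_range (g : MvPolynomial (Fin 3) k) :
    ∃ g', reflHom k (delta k 3 g) = delta k 3 g' := by
  refine ⟨-reflHom k (sigmaHom k 3 g), ?_⟩
  rw [map_neg, delta_apply, delta_apply, sigmaHom_reflHom_sigmaHom, map_sub, neg_sub]

lemma exists_oddForm_mul_evalX0_eq_delta (h2 : (2 : k) ≠ 0) (n : ℕ) :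
    ∃ r : Polynomial (dihedralInvariants k), r.degree < (n : WithBot ℕ) ∧ ∃ g,
      oddForm k * evalX0 k
        (((n + 1 : ℕ) : Polynomial (dihedralInvariants k)) * Polynomial.X ^ n + r) =
          delta k 3 g := by
  obtain ⟨q, r, -, hr, h⟩ := exists_add_oddForm_pow h2 n
  refine ⟨r, hr, ?_⟩
  obtain ⟨s, hs⟩ :
      ∃ s, s = ((n + 1 : ℕ) : Polynomial (dihedralInvariants k)) * Polynomial.X ^ n + r := ⟨_, rfl⟩
  rw [← hs] at h ⊢
  obtain ⟨g, hg⟩ := reflHom_delta_mem_range (X 0 ^ (n + 1) : MvPolynomial (Fin 3) k)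
  refine ⟨C 2⁻¹ * (X 0 ^ (n + 1) - g), ?_⟩
  have h1 : delta k 3 (X 0 ^ (n + 1)) = evalX0 k (Polynomial.X ^ (n + 1) + q) - X 0 ^ (n + 1) +
        oddForm k * evalX0 k s := by
    rw [delta_apply, map_pow, sigmaHom_X0_eq_oddForm, h]
    ring
  have h3 := delta_pow_mul_of_fixed (sigmaHom_C 3 (2⁻¹ : k)) 1
  simp only [pow_one] at h3
  rw [h3, map_sub, ← hg, h1]
  simp only [map_add (reflHom k), map_sub (reflHom k), map_mul (reflHom k), reflHom_oddForm h2,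
    reflHom_evalX0, map_pow (reflHom k), reflHom_X0]
  linear_combination (-oddForm k * evalX0 k s) * two_mul_C_half h2

/-- There is an element of the dihedral invariants which is monic of degree `p` in `x₁`. -/
lemma exists_monic_invariant (hp : p.Prime) (hodd : Odd p) :
    ∃ (N : dihedralInvariants k) (q : Polynomial (dihedralInvariants k)),
      q.degree < (p : WithBot ℕ) ∧ X 0 ^ p = (N : MvPolynomial (Fin 3) k) + evalX0 k q := by
  have h2 : (2 : k) ≠ 0 := two_ne_zero_of_odd_char hp hodd
  have := Fact.mk hp
  obtain ⟨t, ht⟩ := hodd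
  have ht1 : 1 ≤ t := by
    have := hp.two_le
    omega
  obtain ⟨S, hSdeg, hSmul⟩ := exists_aeval_mul_eq_pow_sub_pow (oddForm_sq h2) t
  change evalX0 k S * (2 * X 2 * X 0) = (oddForm k ^ 2) ^ (t + 1) - quadForm k ^ (t + 1) at hSmul
  obtain ⟨q, hqdeg, hqX⟩ : ∃ q : Polynomial (dihedralInvariants k),
      q.degree < ((t + 1 + 1 : ℕ) : WithBot ℕ) ∧
        evalX0 k q = 2 * X 0 * evalX0 k S - X 2 ^ (2 * t) * X 0 := by
    refine ⟨Polynomial.C 2 * (Polynomial.X * S) +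
      Polynomial.C (-invX2 k ^ (2 * t)) * Polynomial.X,
      degree_add_lt (degree_C_mul_lt _ (degree_X_mul_lt hSdeg)) (degree_C_mul_lt _
        (Polynomial.degree_X_le.trans_lt (WithBot.coe_lt_coe.2 (by omega : 1 < t + 1 + 1)))), ?_⟩
    have h1 : evalX0 k (Polynomial.C (-invX2 k ^ (2 * t))) = -X 2 ^ (2 * t) := evalX0_C _
    have h3 : evalX0 k (Polynomial.C 2) = 2 := evalX0_C _
    rw [map_add, map_mul, map_mul, map_mul, h1, h3, evalX0_X]
    ring
  have h2p : (2 : MvPolynomial (Fin 3) k) ^ p = 2 := by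
    simpa [frobenius_def] using map_natCast (frobenius (MvPolynomial (Fin 3) k) p) 2
  have hquad : (oddForm k ^ 2) ^ p = quadForm k ^ p + 2 * X 2 ^ p * X 0 ^ p := by
    rw [show oddForm k ^ 2 = quadForm k + 2 * X 2 * X 0 by rw [quadForm]; ring, add_pow_char,
      mul_pow, mul_pow, h2p]
  have hN : 2 * X 2 ^ p * (X 0 ^ p - evalX0 k q) =
      (oddForm k ^ p - X 2 ^ (2 * t) * oddForm k) ^ 2 - quadForm k ^ p +
        2 * X 2 ^ (2 * t) * quadForm k ^ (t + 1) - X 2 ^ (4 * t) * quadForm k := by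
    have hpow : X 2 ^ p = X 2 * (X 2 ^ (2 * t) : MvPolynomial (Fin 3) k) := by rw [ht]; ring
    have hB : oddForm k ^ p * oddForm k = (oddForm k ^ 2) ^ (t + 1) := by rw [ht]; ring
    have hB2 : (oddForm k ^ p) ^ 2 = (oddForm k ^ 2) ^ p := by ring
    have hz : (X 2 ^ (4 * t) : MvPolynomial (Fin 3) k) = (X 2 ^ (2 * t)) ^ 2 := by ring
    have hquad' : quadForm k = oddForm k ^ 2 - 2 * X 2 * X 0 := rfl
    rw [hqX, hz]
    linear_combination (-1) * hquad - hB2 + 2 * X 2 ^ (2 * t) * hB -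
      2 * X 2 ^ (2 * t) * hSmul + (X 2 ^ (2 * t)) ^ 2 * hquad' +
      (2 * X 2 ^ (2 * t) * X 0 - 4 * X 0 * evalX0 k S) * hpow
  refine ⟨⟨X 0 ^ p - evalX0 k q, mem_dihedralInvariants.2 ⟨?_, ?_⟩⟩, q, ?_, by simp⟩
  · have h3 := congrArg (sigmaHom k 3) hN
    have h4 : sigmaHom k 3 (oddForm k ^ p - X 2 ^ (2 * t) * oddForm k) =
        oddForm k ^ p - X 2 ^ (2 * t) * oddForm k := by
      rw [map_sub, map_mul, map_pow, map_pow, sigmaHom_oddForm, add_pow_char, sigmaHom_X2, ht]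
      ring
    simp only [map_mul (sigmaHom k 3) _ (X 0 ^ p - evalX0 k q),
      map_sub (sigmaHom k 3) _ (X 2 ^ (4 * t) * quadForm k), map_add (sigmaHom k 3),
      map_sub (sigmaHom k 3) _ (quadForm k ^ p), map_pow (sigmaHom k 3) _ 2, h4] at h3
    simp only [map_mul, map_pow, sigmaHom_X2, sigmaHom_quadForm h2, map_ofNat] at h3
    rw [← hN] at h3
    have hne : (2 * X 2 ^ p : MvPolynomial (Fin 3) k) ≠ 0 :=
      mul_ne_zero (fun h => by simpa [h] using two_mul_C_half h2) (pow_ne_zero _ (X_ne_zero _))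
    exact mul_left_cancel₀ hne h3
  · rw [map_sub, map_pow, reflHom_X0, reflHom_evalX0]
  · exact degree_lt_of_degree_lt_of_le hqdeg (by omega)

lemma oddForm_mul_evalX0_mem (hp : p.Prime) (hodd : Odd p)
    (r : Polynomial (dihedralInvariants k)) :
    oddForm k * evalX0 k r ∈ imageDeltaAdd k (oddForm k * X 0 ^ (p - 1)) := by
  have h2 : (2 : k) ≠ 0 := two_ne_zero_of_odd_char hp hodd
  refine mul_evalX0_mem (n := r.natDegree + 1) (fun i _ => ?_)
    (Polynomial.degree_lt_iff_coeff_zero _ _ |>.2 fun m hm =>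
      Polynomial.coeff_eq_zero_of_natDegree_lt hm)
  induction i using Nat.strong_induction_on with
  | _ i ih =>
  rcases lt_trichotomy i (p - 1) with hi | rfl | hi
  · obtain ⟨s, hs, g, hg⟩ := exists_oddForm_mul_evalX0_eq_delta h2 i
    have hne : ((i + 1 : ℕ) : k) ≠ 0 := fun h =>
      absurd (Nat.le_of_dvd i.succ_pos ((CharP.cast_eq_zero_iff k p _).1 h)) (by omega)
    have hmem : oddForm k * evalX0 k
        (((i + 1 : ℕ) : Polynomial (dihedralInvariants k)) * Polynomial.X ^ i + s) ∈
          imageDeltaAdd k (oddForm k * X 0 ^ (p - 1)) := ⟨g, 0, map_zero _, by rw [hg]; ring⟩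
    have h1 := Submodule.sub_mem _ hmem (mul_evalX0_mem (fun l hl => ih l hl (by omega)) hs)
    have h3 := Submodule.smul_mem _ (algebraMap k (dihedralInvariants k) ((i + 1 : ℕ) : k)⁻¹) h1
    convert h3 using 1
    rw [algebraMap_smul, smul_eq_C_mul, map_add, map_mul, map_pow, evalX0_X, map_natCast]
    have h4 : (C ((i + 1 : ℕ) : k)⁻¹ : MvPolynomial (Fin 3) k) * ((i + 1 : ℕ) : _) = 1 := by
      rw [← map_natCast C, ← C_mul, inv_mul_cancel₀ hne, C_1]
    linear_combination (-oddForm k * X 0 ^ i) * h4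
  · exact ⟨0, 1, map_one _, by simp⟩
  · obtain ⟨N, q, hq, hN⟩ := exists_monic_invariant (k := k) hp hodd
    have hip : i - p + p = i := by omega
    have : oddForm k * X 0 ^ i = N • (oddForm k * X 0 ^ (i - p)) +
        (oddForm k * X 0 ^ (i - p)) * evalX0 k q := by
      rw [Subalgebra.smul_def, smul_eq_mul, ← hip, pow_add, hN, hip]
      ring
    rw [this]
    refine add_mem (Submodule.smul_mem _ _ (ih _ (by have := hp.pos; omega) (by omega)))
      (mul_evalX0_mem (fun l hl => ?_) hq)
    rw [mul_assoc, ← pow_add]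
    exact ih _ (by omega) (by omega)

/-! ### Odd invariants -/

lemma isHomogeneous_sigmaHom {m d : ℕ} {f : MvPolynomial (Fin m) k} (hf : f.IsHomogeneous d) :
    (sigmaHom k m f).IsHomogeneous d := by
  rw [← one_mul d]
  refine hf.aeval _ fun i => (isHomogeneous_X _ _).add ?_
  split_ifs
  exacts [isHomogeneous_X _ _, isHomogeneous_zero _ _ _]

lemma isHomogeneous_delta_pow {m d : ℕ} {f : MvPolynomial (Fin m) k} (hf : f.IsHomogeneous d)
    (n : ℕ) : ((delta k m ^ n) f).IsHomogeneous d := by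
  induction n with
  | zero => exact hf
  | succ n ih =>
    rw [pow_succ', Module.End.mul_apply, delta_apply]
    exact (isHomogeneous_sigmaHom ih).sub ih

lemma isHomogeneous_oddForm_add (c : k) : (oddForm k + C c * X 2).IsHomogeneous 1 :=
  ((isHomogeneous_X _ _).sub (isHomogeneous_C_mul_X _ _)).add (isHomogeneous_C_mul_X _ _)

lemma isRelPrime_oddForm_add {a b : k} (hab : a ≠ b) :
    IsRelPrime (oddForm k + C a * X 2) (oddForm k + C b * X 2) := by
  intro d ha hb
  have h2 : d ∣ X 2 := by
    have := dvd_mul_of_dvd_right (dvd_sub ha hb) (C (a - b)⁻¹)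
    rwa [add_sub_add_left_eq_sub, ← sub_mul, ← C_sub, ← mul_assoc, ← C_mul,
      inv_mul_cancel₀ (sub_ne_zero.2 hab), C_1, one_mul] at this
  have h1 : d ∣ X 1 := by
    have := dvd_sub ha (dvd_mul_of_dvd_right h2 (C a - C 2⁻¹))
    rwa [oddForm, show (X 1 - C 2⁻¹ * X 2 + C a * X 2 - (C a - C 2⁻¹) * X 2 :
      MvPolynomial (Fin 3) k) = X 1 by ring] at this
  refine (X_prime.irreducible.isRelPrime_iff_not_dvd.2 fun h => ?_) h1 h2
  exact absurd (X_dvd_X.1 h) (by decide)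

lemma sum_natCast_pow_char_sub_one (hp : p.Prime) :
    ∑ i ∈ Finset.range p, (i : k) ^ (p - 1) = -1 := by
  have := Fact.mk hp
  obtain ⟨q, rfl⟩ := Nat.exists_eq_add_of_le' hp.one_le
  have hq : q ≠ 0 := by have := hp.two_le; omega
  rw [Finset.sum_range_succ', Finset.sum_congr rfl (g := fun _ => (1 : k)) fun i hi => ?_]
  · have h0 : ((q + 1 : ℕ) : k) = 0 := CharP.cast_eq_zero k _
    push_cast at h0
    simp [hq, eq_neg_of_add_eq_zero_left h0]
  · have hi0 : ((i + 1 : ℕ) : k) ≠ 0 := fun h => by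
      have := Nat.le_of_dvd i.succ_pos ((CharP.cast_eq_zero_iff k (q + 1) _).1 h)
      have := Finset.mem_range.1 hi
      omega
    have := map_natCast (frobenius k (q + 1)) (i + 1)
    rw [frobenius_def, pow_succ] at this
    exact mul_right_cancel₀ hi0 (this.trans (one_mul _).symm)

variable (k p) in
/-- The transfer of `(x₂ - x₃ / 2) x₁ ^ (p - 1)`, which generates the odd invariants. -/
def oddTransfer : MvPolynomial (Fin 3) k := (delta k 3 ^ (p - 1)) (oddForm k * X 0 ^ (p - 1))

lemma oddTransfer_ne_zero (hp : p.Prime) (hodd : Odd p) : oddTransfer k p ≠ 0 := by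
  have h2 : (2 : k) ≠ 0 := two_ne_zero_of_odd_char hp hodd
  intro h
  have h0 := congrArg (eval ![(0 : k), 1, 0]) h
  have hB (i : ℕ) : eval ![(0 : k), 1, 0] ((sigmaHom k 3)^[i] (oddForm k)) = 1 := by
    rw [iterate_sigmaHom_oddForm]
    simp [oddForm]
  have hX (i : ℕ) : eval ![(0 : k), 1, 0] ((sigmaHom k 3)^[i] (X 0)) = i := by
    have := congrArg (eval ![(0 : k), 1, 0]) (two_mul_iterate_sigmaHom_X0 h2 i)
    exact mul_left_cancel₀ h2 (by simpa [oddForm] using this)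
  rw [oddTransfer, delta_pow_char_sub_one hp, map_sum] at h0
  simp only [iterate_map_mul, iterate_map_pow, map_mul, map_pow, hB, hX, one_mul, map_zero,
    sum_natCast_pow_char_sub_one hp] at h0
  exact neg_ne_zero.2 one_ne_zero h0

lemma sigmaHom_oddTransfer (hp : p.Prime) (hodd : Odd p) :
    sigmaHom k 3 (oddTransfer k p) = oddTransfer k p := by
  apply sigmaHom_eq_of_delta_eq_zero
  rw [oddTransfer, ← Module.End.mul_apply, ← pow_succ', Nat.sub_add_cancel hp.one_le,
    delta_pow_char hp hodd, LinearMap.zero_apply]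

lemma reflHom_oddTransfer (hp : p.Prime) (hodd : Odd p) :
    reflHom k (oddTransfer k p) = -oddTransfer k p := by
  have h := delta_pow_reflHom hp hodd (sigmaHom_oddTransfer (k := k) hp hodd)
  rw [(Nat.Odd.sub_odd hodd odd_one).neg_one_pow, one_mul, map_mul, map_pow, reflHom_X0,
    reflHom_oddForm (two_ne_zero_of_odd_char hp hodd), neg_mul, map_neg] at h
  exact h.symm

lemma isHomogeneous_oddTransfer {q : ℕ} (hq : q ≠ 0) :
    (oddTransfer k q).IsHomogeneous q := by
  refine isHomogeneous_delta_pow ?_ _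
  have h : (oddForm k).IsHomogeneous 1 := by simpa using isHomogeneous_oddForm_add (0 : k)
  have := h.mul ((isHomogeneous_X k (0 : Fin 3)).pow (q - 1))
  rwa [one_mul, Nat.add_sub_cancel' (Nat.one_le_iff_ne_zero.2 hq)] at this

variable (k p) in
/-- The norm of `x₂ - x₃ / 2`. -/
def oddNorm : MvPolynomial (Fin 3) k := ∏ i ∈ Finset.range p, (oddForm k + C (i : k) * X 2)

lemma isHomogeneous_oddNorm (q : ℕ) : (oddNorm k q).IsHomogeneous q := by
  have := IsHomogeneous.prod (Finset.range q) (fun i => oddForm k + C (i : k) * X 2) (fun _ => 1)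
    fun i _ => isHomogeneous_oddForm_add (i : k)
  rwa [Finset.sum_const, Finset.card_range, smul_eq_mul, mul_one] at this

lemma oddNorm_dvd (h2 : (2 : k) ≠ 0) {f : MvPolynomial (Fin 3) k}
    (hs : sigmaHom k 3 f = f) (hr : reflHom k f = -f) : oddNorm k p ∣ f := by
  refine Finset.prod_dvd_of_isRelPrime (fun i hi j hj hij => ?_) fun i _ => ?_
  · refine isRelPrime_oddForm_add fun h => hij ?_
    exact ((CharP.natCast_eq_natCast k p).1 h).eq_of_lt_of_lt (Finset.mem_range.1 hi)
      (Finset.mem_range.1 hj)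
  · obtain ⟨r, hr⟩ := exists_eq_oddForm_mul_evalX0 h2 hr
    have := congrArg (sigmaHom k 3)^[i] hr
    rw [Function.iterate_fixed hs, iterate_map_mul, iterate_sigmaHom_oddForm,
      ← map_natCast C] at this
    exact ⟨_, this⟩

lemma exists_eq_mul_oddTransfer (hp : p.Prime) (hodd : Odd p) {f : MvPolynomial (Fin 3) k}
    (hs : sigmaHom k 3 f = f) (hr : reflHom k f = -f) :
    ∃ v, sigmaHom k 3 v = v ∧ f = v * oddTransfer k p := by
  have h2 : (2 : k) ≠ 0 := two_ne_zero_of_odd_char hp hodd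
  have hne := oddTransfer_ne_zero (k := k) hp hodd
  have hT := sigmaHom_oddTransfer (k := k) hp hodd
  obtain ⟨l, hl⟩ := oddNorm_dvd (p := p) h2 hT (reflHom_oddTransfer hp hodd)
  obtain ⟨u, rfl⟩ := oddNorm_dvd (p := p) h2 hs hr
  have hN0 : oddNorm k p ≠ 0 := fun h => hne (by rw [hl, h, zero_mul])
  have hl0 : l ≠ 0 := fun h => hne (by rw [hl, h, mul_zero])
  have hdeg : l.totalDegree = 0 := by
    have := totalDegree_mul_of_isDomain hN0 hl0
    rw [← hl, (isHomogeneous_oddTransfer hp.ne_zero).totalDegree hne,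
      (isHomogeneous_oddNorm p).totalDegree hN0] at this
    omega
  rw [totalDegree_eq_zero_iff_eq_C] at hdeg
  obtain ⟨c, rfl⟩ : ∃ c, l = C c := ⟨_, hdeg⟩
  have hc : c ≠ 0 := fun h => hl0 (by rw [h, C_0])
  have huv : oddNorm k p * u = C c⁻¹ * u * oddTransfer k p := by
    have : (C c⁻¹ : MvPolynomial (Fin 3) k) * C c = 1 := by
      rw [← C_mul, inv_mul_cancel₀ hc, C_1]
    rw [hl]
    linear_combination (-oddNorm k p * u) * this
  refine ⟨C c⁻¹ * u, ?_, huv⟩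
  rw [huv, map_mul, hT] at hs
  exact mul_right_cancel₀ hne hs

/-! ### The main argument -/

/-- For odd `n < p - 1`, an invariant in the image of `Δ ^ n` lies in the image of `Δ ^ (n + 1)`. -/
lemma exists_delta_pow_eq (hp : p.Prime) (hodd : Odd p) {n : ℕ} (hn : Odd n) (hnp : n + 1 ≤ p - 1)
    {f : MvPolynomial (Fin 3) k} (hf : (delta k 3 ^ (n + 1)) f = 0) :
    ∃ g, (delta k 3 ^ n) f = (delta k 3 ^ (n + 1)) g := by
  have h2 : (2 : k) ≠ 0 := two_ne_zero_of_odd_char hp hodd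
  have hhalf := two_mul_C_half h2
  obtain ⟨w, hw⟩ : ∃ w, (delta k 3 ^ n) f = w := ⟨_, rfl⟩
  have hsw : sigmaHom k 3 w = w := by
    apply sigmaHom_eq_of_delta_eq_zero
    rw [← hw, ← Module.End.mul_apply, ← pow_succ', hf]
  have hsrw : sigmaHom k 3 (reflHom k w) = reflHom k w := by
    have := sigmaHom_reflHom_sigmaHom w
    rwa [hsw] at this
  have hrf : (delta k 3 ^ n) (reflHom k f) = -reflHom k w := by
    have := delta_pow_reflHom hp hodd (n := n) (f := f) (by rw [hw, hsw])
    rwa [hn.neg_one_pow, hw, neg_one_mul] at this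
  have hC (m : ℕ) (q : MvPolynomial (Fin 3) k) :
      (delta k 3 ^ m) (C 2⁻¹ * q) = C 2⁻¹ * (delta k 3 ^ m) q :=
    delta_pow_mul_of_fixed (sigmaHom_C 3 _) m q
  obtain ⟨v, hv, hvw⟩ := exists_eq_mul_oddTransfer hp hodd (f := C 2⁻¹ * (w - reflHom k w))
    (by rw [map_mul, map_sub, hsw, hsrw, sigmaHom_C])
    (by rw [map_mul, map_sub, reflHom_reflHom, reflHom_C]; ring)
  have hodd' : reflHom k (C 2⁻¹ * (f - reflHom k f)) = -(C 2⁻¹ * (f - reflHom k f)) := by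
    rw [map_mul, map_sub, reflHom_reflHom, reflHom_C]; ring
  obtain ⟨r, hr⟩ := exists_eq_oddForm_mul_evalX0 h2 hodd'
  obtain ⟨g, u, hu, hgu⟩ := oddForm_mul_evalX0_mem hp hodd r
  rw [← hr] at hgu
  have hfo : (delta k 3 ^ n) (C 2⁻¹ * (f - reflHom k f)) = C 2⁻¹ * (w + reflHom k w) := by
    rw [hC, map_sub, hw, hrf, sub_neg_eq_add]
  have hfo' : (delta k 3 ^ (p - 1)) (C 2⁻¹ * (f - reflHom k f)) = 0 := by
    rw [show p - 1 = (p - 1 - (n + 1)) + (1 + n) by omega, pow_add, pow_add, Module.End.mul_apply,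
      Module.End.mul_apply, hfo, pow_one, delta_apply, map_mul, map_add, hsw, hsrw, sigmaHom_C,
      sub_self, map_zero]
  have hu0 : u = 0 := by
    rw [hgu, map_add, ← Module.End.mul_apply, ← pow_succ, Nat.sub_add_cancel hp.one_le,
      delta_pow_char hp hodd, LinearMap.zero_apply, zero_add, delta_pow_mul_of_fixed hu] at hfo'
    exact (mul_eq_zero.1 hfo').resolve_right (oddTransfer_ne_zero hp hodd)
  rw [hgu, hu0, zero_mul, add_zero, ← Module.End.mul_apply, ← pow_succ] at hfo
  refine ⟨g + v * (delta k 3 ^ (p - 1 - (n + 1))) (oddForm k * X 0 ^ (p - 1)), ?_⟩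
  rw [map_add, hfo, delta_pow_mul_of_fixed hv, ← Module.End.mul_apply, ← pow_add,
    Nat.add_sub_cancel' hnp, hw]
  rw [oddTransfer] at hvw
  rw [← hvw]
  linear_combination -w * hhalf

lemma sigmaHom_homogeneousComponent {m : ℕ} (d : ℕ) (f : MvPolynomial (Fin m) k) :
    homogeneousComponent d (sigmaHom k m f) = sigmaHom k m (homogeneousComponent d f) := by
  conv_lhs => rw [← sum_homogeneousComponent f, map_sum, map_sum]
  conv_rhs => rw [← sum_homogeneousComponent f, map_sum, map_sum]
  refine Finset.sum_congr rfl fun i _ => ?_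
  have h := homogeneousComponent_isHomogeneous i f
  rw [homogeneousComponent_of_mem h, homogeneousComponent_of_mem (isHomogeneous_sigmaHom h)]
  split_ifs
  exacts [rfl, (map_zero _).symm]

lemma delta_pow_homogeneousComponent {m : ℕ} (n d : ℕ) (f : MvPolynomial (Fin m) k) :
    homogeneousComponent d ((delta k m ^ n) f) = (delta k m ^ n) (homogeneousComponent d f) := by
  induction n with
  | zero => rfl
  | succ n ih =>
    rw [pow_succ', Module.End.mul_apply, Module.End.mul_apply, delta_apply, delta_apply, map_sub,
      sigmaHom_homogeneousComponent, ih]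

end

/-- Let `p` be an odd prime.  For every even `j` with `1 ≤ j ≤ p−1` and every
degree `d`, the multiplicity of `V_j` in `k[V_3]_d` is zero. -/
theorem statement6 (p : ℕ) (hp : p.Prime) (hodd : Odd p)
    (k : Type*) [Field k] [CharP k p]
    (j : ℕ) (hj1 : 1 ≤ j) (hjp : j ≤ p - 1) (hje : Even j) (d : ℕ) :
    mult k 3 j (homogeneousSubmodule (Fin 3) k d) = 0 := by
  obtain ⟨n, rfl⟩ := Nat.exists_eq_add_of_le' hj1
  rw [mult, sub_eq_zero, Nat.add_sub_cancel]
  suffices h : Submodule.map (delta k 3 ^ n) (homogeneousSubmodule (Fin 3) k d) ⊓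
      LinearMap.ker (delta k 3) = Submodule.map (delta k 3 ^ (n + 1))
        (homogeneousSubmodule (Fin 3) k d) ⊓ LinearMap.ker (delta k 3) by rw [h]
  refine le_antisymm ?_ ?_
  · rintro _ ⟨⟨f, hf, rfl⟩, hker⟩
    refine ⟨?_, hker⟩
    have hf0 : (delta k 3 ^ (n + 1)) f = 0 := by
      rw [pow_succ', Module.End.mul_apply]
      exact hker
    obtain ⟨g, hg⟩ := exists_delta_pow_eq hp hodd (by grind) hjp hf0
    refine ⟨homogeneousComponent d g, homogeneousComponent_mem d g, ?_⟩
    rw [← delta_pow_homogeneousComponent, ← hg,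
      homogeneousComponent_of_mem (isHomogeneous_delta_pow hf n), if_pos rfl]
  · refine inf_le_inf_right _ ?_
    rintro _ ⟨f, hf, rfl⟩
    refine ⟨delta k 3 f, ?_, by rw [pow_succ, Module.End.mul_apply]⟩
    simpa using isHomogeneous_delta_pow hf 1
end

section
/- Let z = x_1^{e_1} x_2^{e_2} ⋯ x_m^{e_m} be a monomial in k[V_m], set d = Σ_{i=1}^{m} e_i(m−i), and assume d < p. Then wt(z) = d+1, and Δ^{d}(z) = λ·x_m^{deg(z)} for some nonzero constant λ ∈ k. -/
open MvPolynomial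

/-- The weight of `f ∈ k[V_m]`:  `wt(f) = min { i > 0 : Δ^i(f) = 0 }`. -/
noncomputable def wt (k : Type*) [Field k] (m : ℕ) (f : MvPolynomial (Fin m) k) : ℕ :=
  sInf {i : ℕ | 0 < i ∧ (delta k m ^ i) f = 0}

theorem delta_mul {k : Type*} [CommRing k] {m : ℕ} (f g : MvPolynomial (Fin m) k) :
    delta k m (f * g) =
      delta k m f * g + f * delta k m g + delta k m f * delta k m g := by
  simp only [delta, LinearMap.sub_apply, AlgHom.toLinearMap_apply, LinearMap.id_apply, map_mul]
  ring

theorem delta_pow_mul_eq_zero {k : Type*} [CommRing k] {m : ℕ} (n : ℕ) :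
    ∀ {a b : ℕ} {f g : MvPolynomial (Fin m) k}, a + b ≤ n + 1 →
      (delta k m ^ a) f = 0 → (delta k m ^ b) g = 0 → (delta k m ^ n) (f * g) = 0 := by
  induction n with
  | zero =>
    intro a b f g hab hf hg
    rcases Nat.eq_zero_or_pos a with rfl | ha
    · have hf0 : f = 0 := by simpa using hf
      simp [hf0]
    · obtain rfl : b = 0 := by omega
      have hg0 : g = 0 := by simpa using hg
      simp [hg0]
  | succ n ih =>
    intro a b f g hab hf hg
    rcases a with _ | a
    · have hf0 : f = 0 := by simpa using hf
      simp [hf0]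
    rcases b with _ | b
    · have hg0 : g = 0 := by simpa using hg
      simp [hg0]
    have hf' : (delta k m ^ a) (delta k m f) = 0 := by
      rwa [pow_succ, Module.End.mul_apply] at hf
    have hg' : (delta k m ^ b) (delta k m g) = 0 := by
      rwa [pow_succ, Module.End.mul_apply] at hg
    rw [pow_succ, Module.End.mul_apply, delta_mul, map_add, map_add,
      ih (by omega) hf' hg, ih (by omega) hf hg', ih (by omega) hf' hg', add_zero, add_zero]

theorem delta_pow_mul_of_delta_eq_zero {k : Type*} [CommRing k] {m : ℕ}
    {f : MvPolynomial (Fin m) k} (hf : delta k m f = 0) (g : MvPolynomial (Fin m) k) (b : ℕ) :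
    (delta k m ^ b) (f * g) = f * (delta k m ^ b) g := by
  induction b with
  | zero => simp
  | succ b ih =>
    rw [pow_succ', Module.End.mul_apply, ih, delta_mul, hf, Module.End.mul_apply]
    ring

/-- The leading term of the Leibniz rule for the twisted derivation `Δ`. -/
theorem delta_pow_add_mul {k : Type*} [CommRing k] {m : ℕ} (n : ℕ) :
    ∀ {a b : ℕ} {f g : MvPolynomial (Fin m) k}, a + b = n →
      (delta k m ^ (a + 1)) f = 0 → (delta k m ^ (b + 1)) g = 0 →
      (delta k m ^ n) (f * g) =
        (n.choose a : MvPolynomial (Fin m) k) * ((delta k m ^ a) f * (delta k m ^ b) g) := by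
  induction n with
  | zero =>
    intro a b f g hab _ _
    obtain ⟨rfl, rfl⟩ : a = 0 ∧ b = 0 := by omega
    simp
  | succ n ih =>
    intro a b f g hab hf hg
    rcases a with _ | a
    · obtain rfl : b = n + 1 := by omega
      rw [delta_pow_mul_of_delta_eq_zero (by simpa using hf)]
      simp
    rcases b with _ | b
    · obtain rfl : a = n := by omega
      rw [mul_comm f g, delta_pow_mul_of_delta_eq_zero (by simpa using hg)]
      simp [mul_comm]
    have hf' : (delta k m ^ (a + 1)) (delta k m f) = 0 := by
      rwa [pow_succ, Module.End.mul_apply] at hf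
    have hg' : (delta k m ^ (b + 1)) (delta k m g) = 0 := by
      rwa [pow_succ, Module.End.mul_apply] at hg
    rw [pow_succ, Module.End.mul_apply, delta_mul, map_add, map_add,
      ih (a := a) (b := b + 1) (by omega) hf' hg, ih (a := a + 1) (b := b) (by omega) hf hg',
      delta_pow_mul_eq_zero n (by omega) hf' hg', Nat.choose_succ_succ]
    simp only [← Module.End.mul_apply, ← pow_succ]
    push_cast
    ring

theorem delta_C_mul_X_last_pow {k : Type*} [CommRing k] {m : ℕ} (hm : 1 ≤ m) (c : k) (n : ℕ) :
    delta k m (C c * X (⟨m - 1, by omega⟩ : Fin m) ^ n) = 0 := by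
  have h : ¬ m - 1 + 1 < m := by omega
  simp [delta, sigmaHom, h]

theorem delta_pow_X {k : Type*} [CommRing k] {m : ℕ} (hm : 1 ≤ m) (j : ℕ) :
    ∀ i : Fin m, m - 1 - (i : ℕ) = j →
      (delta k m ^ j) (X i) = X (⟨m - 1, by omega⟩ : Fin m) := by
  induction j with
  | zero =>
    intro i hi
    have : i = ⟨m - 1, by omega⟩ := Fin.ext (by have := i.2; simp only; omega)
    simp [← this]
  | succ j ih =>
    intro i hi
    have h : (i : ℕ) + 1 < m := by omega
    have hX : delta k m (X i) = X ⟨(i : ℕ) + 1, h⟩ := by simp [delta, sigmaHom, h]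
    rw [pow_succ, Module.End.mul_apply, hX, ih _ (by simp only; omega)]

/-- `Δ^a f` is a nonzero scalar multiple of `x_m^n`. -/
def DeltaPowIsLastPow (k : Type*) [CommRing k] {m : ℕ} (hm : 1 ≤ m) (a n : ℕ)
    (f : MvPolynomial (Fin m) k) : Prop :=
  ∃ c : k, c ≠ 0 ∧ (delta k m ^ a) f = C c * X (⟨m - 1, by omega⟩ : Fin m) ^ n

theorem DeltaPowIsLastPow.delta_pow_succ {k : Type*} [CommRing k] {m : ℕ} {hm : 1 ≤ m}
    {a n : ℕ} {f : MvPolynomial (Fin m) k} (hf : DeltaPowIsLastPow k hm a n f) :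
    (delta k m ^ (a + 1)) f = 0 := by
  obtain ⟨c, -, hc⟩ := hf
  rw [pow_succ', Module.End.mul_apply, hc, delta_C_mul_X_last_pow hm]

theorem DeltaPowIsLastPow.one {k : Type*} [CommRing k] [Nontrivial k] {m : ℕ} (hm : 1 ≤ m) :
    DeltaPowIsLastPow k hm 0 0 1 :=
  ⟨1, one_ne_zero, by simp⟩

theorem DeltaPowIsLastPow.mul {p : ℕ} (hp : p.Prime) {k : Type*} [Field k] [CharP k p] {m : ℕ}
    {hm : 1 ≤ m} {a b n r : ℕ} {f g : MvPolynomial (Fin m) k} (hab : a + b < p)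
    (hf : DeltaPowIsLastPow k hm a n f) (hg : DeltaPowIsLastPow k hm b r g) :
    DeltaPowIsLastPow k hm (a + b) (n + r) (f * g) := by
  have key := delta_pow_add_mul (a + b) rfl hf.delta_pow_succ hg.delta_pow_succ
  obtain ⟨c, hc, hcf⟩ := hf
  obtain ⟨c', hc', hcg⟩ := hg
  have hchoose : ((a + b).choose a : k) ≠ 0 := by
    rw [Ne, CharP.cast_eq_zero_iff k p]
    intro h
    have hdvd : (a + b).choose a ∣ (a + b).factorial :=
      ⟨a.factorial * b.factorial, by
        simpa [mul_assoc] using (Nat.choose_mul_factorial_mul_factorial (Nat.le_add_right a b)).symm⟩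
    exact absurd ((hp.dvd_factorial).1 (h.trans hdvd)) (by omega)
  refine ⟨(a + b).choose a * (c * c'), mul_ne_zero hchoose (mul_ne_zero hc hc'), ?_⟩
  rw [key, hcf, hcg, C_mul, C_mul, map_natCast]
  ring

theorem DeltaPowIsLastPow.pow {p : ℕ} (hp : p.Prime) {k : Type*} [Field k] [CharP k p] {m : ℕ}
    {hm : 1 ≤ m} {a n : ℕ} {f : MvPolynomial (Fin m) k} (hf : DeltaPowIsLastPow k hm a n f)
    (e : ℕ) (he : e * a < p) : DeltaPowIsLastPow k hm (e * a) (e * n) (f ^ e) := by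
  induction e with
  | zero => simpa using DeltaPowIsLastPow.one hm
  | succ e ih =>
    rw [Nat.succ_mul] at he
    rw [Nat.succ_mul, Nat.succ_mul, pow_succ]
    exact (ih (by omega)).mul hp he hf

theorem DeltaPowIsLastPow.prod {p : ℕ} (hp : p.Prime) {k : Type*} [Field k] [CharP k p] {m : ℕ}
    {hm : 1 ≤ m} {ι : Type*} (s : Finset ι) {a n : ι → ℕ} {f : ι → MvPolynomial (Fin m) k}
    (hs : ∑ i ∈ s, a i < p)
    (hf : ∀ i, a i < p → DeltaPowIsLastPow k hm (a i) (n i) (f i)) :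
    DeltaPowIsLastPow k hm (∑ i ∈ s, a i) (∑ i ∈ s, n i) (∏ i ∈ s, f i) := by
  classical
  induction s using Finset.induction_on with
  | empty => simpa using DeltaPowIsLastPow.one hm
  | insert i s hi ih =>
    rw [Finset.sum_insert hi] at hs
    rw [Finset.sum_insert hi, Finset.sum_insert hi, Finset.prod_insert hi]
    exact (hf i (by omega)).mul hp hs (ih (by omega))

theorem DeltaPowIsLastPow.wt_eq {k : Type*} [Field k] {m : ℕ} {hm : 1 ≤ m} {a n : ℕ}
    {f : MvPolynomial (Fin m) k} (hf : DeltaPowIsLastPow k hm a n f) : wt k m f = a + 1 := by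
  have hmem : a + 1 ∈ {i : ℕ | 0 < i ∧ (delta k m ^ i) f = 0} :=
    ⟨a.succ_pos, hf.delta_pow_succ⟩
  refine le_antisymm (Nat.sInf_le hmem) (le_csInf ⟨_, hmem⟩ ?_)
  rintro i ⟨-, hi⟩
  by_contra! hlt
  obtain ⟨c, hc, hcf⟩ := hf
  have hzero : (delta k m ^ a) f = 0 := by
    rw [← Nat.sub_add_cancel (Nat.lt_succ_iff.1 hlt), pow_add, Module.End.mul_apply, hi, map_zero]
  rw [hcf] at hzero
  exact mul_ne_zero (C_ne_zero.2 hc) (pow_ne_zero n (X_ne_zero _)) hzero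

/-- Let `z = x_1^{e_1} ⋯ x_m^{e_m}` and `d = Σ_i e_i (m−i)` (1-indexed), and
assume `d < p`.  Then `wt(z) = d+1` and `Δ^d(z) = λ x_m^{deg z}` for some
nonzero `λ ∈ k`. -/
theorem statement8 (p : ℕ) (hp : p.Prime) (k : Type*) [Field k] [CharP k p]
    (m : ℕ) (hm : 1 ≤ m) (hmp : m ≤ p)
    (e : Fin m → ℕ) (d : ℕ)
    (hd : d = ∑ i : Fin m, e i * (m - 1 - (i : ℕ))) (hdp : d < p) :
    wt k m (∏ i : Fin m, X i ^ e i) = d + 1 ∧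
    ∃ lam : k, lam ≠ 0 ∧
      (delta k m ^ d) (∏ i : Fin m, X i ^ e i) =
        C lam * X (⟨m - 1, by omega⟩ : Fin m) ^ (∑ i : Fin m, e i) := by
  have hz : DeltaPowIsLastPow k hm d (∑ i, e i) (∏ i, X i ^ e i) := by
    subst hd
    refine DeltaPowIsLastPow.prod hp Finset.univ hdp fun i hi => ?_
    have hX : DeltaPowIsLastPow k hm (m - 1 - (i : ℕ)) 1 (X i) :=
      ⟨1, one_ne_zero, by simpa using delta_pow_X hm _ i rfl⟩
    simpa using hX.pow hp (e i) hi
  exact ⟨hz.wt_eq, hz⟩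
end

section
/- For every j = 1,…,m and every f ∈ k[V_m], Δ(∂_j f) = ∂_j(Δ f) + Σ_{i=1}^{j−1} (−1)^i ∂_{j−i}(σ f). -/
open MvPolynomial

theorem pderiv_zero_sigmaHom {k : Type*} [CommRing k] {m : ℕ} (h : 0 < m)
    (f : MvPolynomial (Fin m) k) :
    pderiv ⟨0, h⟩ (sigmaHom k m f) = sigmaHom k m (pderiv ⟨0, h⟩ f) := by
  induction f using MvPolynomial.induction_on with
  | C a => simp [sigmaHom]
  | add f g hf hg => simp only [map_add, hf, hg]
  | mul_X f i hf =>
    have hX : pderiv ⟨0, h⟩ (sigmaHom k m (X i)) = sigmaHom k m (pderiv ⟨0, h⟩ (X i)) := by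
      simp only [sigmaHom, aeval_X, map_add, pderiv_X, Pi.single_apply]
      split_ifs <;> simp_all [pderiv_X, Fin.ext_iff]
    simp only [map_mul, Derivation.leibniz, smul_eq_mul, map_add, hf, hX]

theorem pderiv_succ_sigmaHom {k : Type*} [CommRing k] {m n : ℕ} (h : n + 1 < m)
    (f : MvPolynomial (Fin m) k) :
    pderiv ⟨n + 1, h⟩ (sigmaHom k m f) =
      sigmaHom k m (pderiv ⟨n + 1, h⟩ f) + sigmaHom k m (pderiv ⟨n, by omega⟩ f) := by
  induction f using MvPolynomial.induction_on with
  | C a => simp [sigmaHom]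
  | add f g hf hg => simp only [map_add, hf, hg]; ring
  | mul_X f i hf =>
    have hX : pderiv ⟨n + 1, h⟩ (sigmaHom k m (X i)) =
        sigmaHom k m (pderiv ⟨n + 1, h⟩ (X i)) + sigmaHom k m (pderiv ⟨n, by omega⟩ (X i)) := by
      simp only [sigmaHom, aeval_X, map_add, pderiv_X, Pi.single_apply]
      split_ifs <;> simp_all [pderiv_X, Fin.ext_iff]
    simp only [map_mul, Derivation.leibniz, smul_eq_mul, map_add, hf, hX]
    ring

theorem sigmaHom_pderiv {k : Type*} [CommRing k] {m : ℕ} (n : ℕ) (h : n < m)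
    (f : MvPolynomial (Fin m) k) :
    sigmaHom k m (pderiv ⟨n, h⟩ f) =
      ∑ i ∈ Finset.range (n + 1),
        (-1 : MvPolynomial (Fin m) k) ^ i *
          pderiv ⟨n - i, Nat.lt_of_le_of_lt (Nat.sub_le _ _) h⟩ (sigmaHom k m f) := by
  induction n with
  | zero => simp [pderiv_zero_sigmaHom]
  | succ n ih =>
    rw [Finset.sum_range_succ', eq_sub_of_add_eq (pderiv_succ_sigmaHom h f).symm,
      ih (by omega)]
    simp only [Nat.add_sub_add_right, pow_succ, mul_neg, mul_one, neg_mul,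
      Finset.sum_neg_distrib, pow_zero, one_mul, Nat.sub_zero]
    ring

/-- For every variable `x_j` of `k[V_m]` and every `f ∈ k[V_m]`,
`Δ(∂_j f) = ∂_j(Δ f) + Σ_{i=1}^{j−1} (−1)^i ∂_{j−i}(σ f)`
(1-indexed; here `j : Fin m` is 0-indexed, so the sum runs over `1 ≤ i ≤ j`). -/
theorem statement10 (p : ℕ) (hp : p.Prime) (k : Type*) [Field k] [CharP k p]
    (m : ℕ) (hm : 1 ≤ m) (hmp : m ≤ p)
    (j : Fin m) (f : MvPolynomial (Fin m) k) :
    delta k m (pderiv j f) =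
      pderiv j (delta k m f) +
      ∑ i ∈ Finset.Icc 1 (j : ℕ),
        (-1 : MvPolynomial (Fin m) k) ^ i *
          pderiv (⟨(j : ℕ) - i, Nat.lt_of_le_of_lt (Nat.sub_le _ _) j.isLt⟩ : Fin m)
            (sigmaHom k m f) := by
  have hσ := sigmaHom_pderiv (j : ℕ) j.isLt f
  rw [Finset.range_eq_Ico, Finset.sum_eq_sum_Ico_succ_bot (Nat.succ_pos _)] at hσ
  have hI : Finset.Icc 1 (j : ℕ) = Finset.Ico (0 + 1) ((j : ℕ) + 1) := by
    ext
    simp only [Finset.mem_Icc, Finset.mem_Ico]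
    omega
  rw [hI]
  simp only [Nat.sub_zero, pow_zero, one_mul, Fin.eta] at hσ
  simp only [delta, LinearMap.sub_apply, AlgHom.toLinearMap_apply, LinearMap.id_apply, map_sub, hσ]
  ring
end
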